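/- arXiv:2203.13225 — 9 statements merged into one kernel-verified Lean document; each statement's English description precedes it below -/
import Mathlib

section
/- Assume each ℓ_j is convex, differentiable and G-Lipschitz, and satisfies the mean-square smoothness condition: for all x, x' ∈ B_r(x̄) ∩ 𝒳 and all i ∈ [M], Σ_{j∈[N]} w_{ij} ‖∇ℓ_j(x) − ∇ℓ_j(x')‖² ≤ L²‖x − x'‖². Let r = ε'/G, 0 < λ ≤ G/r, and x, x' ∈ B_r(x̄) ∩ 𝒳. Then there is an absolute constant C such that the SVRG-like estimator ĝ_{x'}(x) = ∇Γ_{ε,λ}(x') + (M̂c/ε')[ M̂[γ_i(x,x')] ∇ℓ_j^λ(x) − γ_i(x',x') ∇ℓ_j^λ(x') ] (with i ∼ p_i(x') = e^{𝓛_i(x')/ε'}/Σ_k e^{𝓛_k(x')/ε'}, j ∼ w_i, M̂c = (Σ_k e^{𝓛_k(x')/ε'})/(Σ_k e^{𝓛_k(x̄)/ε'}), ∇ℓ_j^λ(x) = ∇ℓ_j(x) + λ(x − x̄)) satisfies Var(ĝ_{x'}(x)) := E‖ĝ_{x'}(x) − E ĝ_{x'}(x)‖² ≤ C (L + λ + G²/ε')²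 ‖x − x'‖². -/
open Real

noncomputable section

/-- Group loss `𝓛_i(x) = Σ_j w_{ij} ℓ_j(x)`. -/
def groupLoss {d N M : ℕ} (w : Fin M → Fin N → ℝ)
    (ℓ : Fin N → EuclideanSpace ℝ (Fin d) → ℝ) (i : Fin M)
    (x : EuclideanSpace ℝ (Fin d)) : ℝ :=
  ∑ j, w i j * ℓ j x

/-- `γ̂(x,x'; s₁,…,sₙ)` evaluated on the first `n` terms of the sample sequence `s`. -/
def gammaHat {d N : ℕ} (ℓ : Fin N → EuclideanSpace ℝ (Fin d) → ℝ) (ε' lam : ℝ)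
    (xbar x x' : EuclideanSpace ℝ (Fin d)) (n : ℕ) (s : ℕ → Fin N) : ℝ :=
  ε' * Real.exp (((n : ℝ)⁻¹ * ∑ k ∈ Finset.range n, (ℓ (s k) x - ℓ (s k) x') +
      lam / 2 * ‖x - xbar‖ ^ 2) / ε')

/-- `D̂_{2m}`. -/
def dHat {d N : ℕ} (ℓ : Fin N → EuclideanSpace ℝ (Fin d) → ℝ) (ε' lam : ℝ)
    (xbar x x' : EuclideanSpace ℝ (Fin d)) (m : ℕ) (s : ℕ → Fin N) : ℝ :=
  gammaHat ℓ ε' lam xbar x x' (2 * m) s -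
    (gammaHat ℓ ε' lam xbar x x' m s + gammaHat ℓ ε' lam xbar x x' m (fun k => s (m + k))) / 2

/-- `p_j = (1 − 8^{−1/2}) 8^{−j/2}`. -/
def geomP (j : ℕ) : ℝ := (1 - (Real.sqrt 8)⁻¹) * ((Real.sqrt 8)⁻¹) ^ j

/-- MLMC estimator value at level `j`: `γ̂(x,x'; S₁) + D̂_{2^j}/p_j`, with `D̂_1 = 0`. -/
def mlmcVal {d N : ℕ} (ℓ : Fin N → EuclideanSpace ℝ (Fin d) → ℝ) (ε' lam : ℝ)
    (xbar x x' : EuclideanSpace ℝ (Fin d)) (j : ℕ) (s : ℕ → Fin N) : ℝ :=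
  gammaHat ℓ ε' lam xbar x x' 1 s +
    (if j = 0 then 0 else dHat ℓ ε' lam xbar x x' (2 ^ (j - 1)) s) / geomP j

/-- Extends a finite sample tuple to an infinite sequence. -/
def extSeq {N n : ℕ} (hn : 0 < n) (s : Fin n → Fin N) : ℕ → Fin N :=
  fun k => if h : k < n then s ⟨k, h⟩ else s ⟨0, hn⟩

/-- `j`-th term of the expectation of the scalar `f(J, S₁, S₂, …)`, `S ~ w_i` i.i.d. -/
def mlmcSummand {N M : ℕ} (w : Fin M → Fin N → ℝ) (i : Fin M)
    (ℱ : ℕ → (ℕ → Fin N) → ℝ) (j : ℕ) : ℝ :=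
  geomP j * ∑ s : Fin (2 ^ j) → Fin N,
    (∏ k, w i (s k)) * ℱ j (extSeq (Nat.two_pow_pos j) s)

/-- `j`-th term of the expectation of the vector-valued `f(J, S₁, S₂, …)`. -/
def mlmcSummandVec {d N M : ℕ} (w : Fin M → Fin N → ℝ) (i : Fin M)
    (ℱ : ℕ → (ℕ → Fin N) → EuclideanSpace ℝ (Fin d)) (j : ℕ) :
    EuclideanSpace ℝ (Fin d) :=
  geomP j • ∑ s : Fin (2 ^ j) → Fin N,
    (∏ k, w i (s k)) • ℱ j (extSeq (Nat.two_pow_pos j) s)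

/-- finite product expectation -/
def Ex {N : ℕ} (w : Fin N → ℝ) (n : ℕ) (h : (Fin n → Fin N) → ℝ) : ℝ :=
  ∑ s : Fin n → Fin N, (∏ k, w (s k)) * h s

lemma Ex_succ {N : ℕ} (w : Fin N → ℝ) (n : ℕ) (h : (Fin (n+1) → Fin N) → ℝ) :
    Ex w (n+1) h = ∑ a, w a * Ex w n (fun s => h (Fin.cons a s)) := by
  unfold Ex
  rw [← (Fin.consEquiv (fun _ : Fin (n+1) => Fin N)).sum_comp, Fintype.sum_prod_type]
  refine Finset.sum_congr rfl fun a _ => ?_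
  rw [Finset.mul_sum]
  refine Finset.sum_congr rfl fun s _ => ?_
  simp [Fin.consEquiv, Fin.prod_univ_succ, mul_assoc]

lemma Ex_add {N : ℕ} (w : Fin N → ℝ) (n : ℕ) (h g : (Fin n → Fin N) → ℝ) :
    Ex w n (fun s => h s + g s) = Ex w n h + Ex w n g := by
  simp [Ex, mul_add, Finset.sum_add_distrib]

lemma Ex_mul {N : ℕ} (w : Fin N → ℝ) (n : ℕ) (c : ℝ) (h : (Fin n → Fin N) → ℝ) :
    Ex w n (fun s => c * h s) = c * Ex w n h := by
  simp only [Ex, Finset.mul_sum]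
  exact Finset.sum_congr rfl fun s _ => by ring

lemma Ex_const {N : ℕ} (w : Fin N → ℝ) (hw : w ∈ stdSimplex ℝ (Fin N)) (n : ℕ) (c : ℝ) :
    Ex w n (fun _ => c) = c := by
  induction n with
  | zero => simp [Ex]
  | succ n ih => rw [Ex_succ]; simp only [ih]; rw [← Finset.sum_mul, hw.2, one_mul]

lemma Ex_mono {N : ℕ} (w : Fin N → ℝ) (hw : w ∈ stdSimplex ℝ (Fin N)) (n : ℕ)
    (h g : (Fin n → Fin N) → ℝ) (hg : ∀ s, h s ≤ g s) :
    Ex w n h ≤ Ex w n g := by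
  unfold Ex
  exact Finset.sum_le_sum fun s _ =>
    mul_le_mul_of_nonneg_left (hg s) (Finset.prod_nonneg fun k _ => hw.1 _)

lemma Ex_nonneg {N : ℕ} (w : Fin N → ℝ) (hw : w ∈ stdSimplex ℝ (Fin N)) (n : ℕ)
    (h : (Fin n → Fin N) → ℝ) (hg : ∀ s, 0 ≤ h s) : 0 ≤ Ex w n h := by
  have := Ex_mono w hw n (fun _ => 0) h hg
  rwa [Ex_const w hw] at this

lemma wavg_le {N : ℕ} (w : Fin N → ℝ) (hw : w ∈ stdSimplex ℝ (Fin N)) (g : Fin N → ℝ) (B : ℝ)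
    (h : ∀ a, g a ≤ B) : ∑ a, w a * g a ≤ B := by
  calc ∑ a, w a * g a ≤ ∑ a, w a * B :=
        Finset.sum_le_sum fun a _ => mul_le_mul_of_nonneg_left (h a) (hw.1 a)
    _ = B := by rw [← Finset.sum_mul, hw.2, one_mul]

lemma moments {N : ℕ} (w : Fin N → ℝ) (hw : w ∈ stdSimplex ℝ (Fin N)) (c : ℝ) (hc : 0 ≤ c) (n : ℕ) :
    ∀ (f : Fin n → Fin N → ℝ) (_ : ∀ k, ∑ a, w a * f k a = 0) (_ : ∀ k a, |f k a| ≤ c),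
    Ex w n (fun s => ∑ k, f k (s k)) = 0 ∧
    Ex w n (fun s => (∑ k, f k (s k)) ^ 2) ≤ n * c ^ 2 ∧
    Ex w n (fun s => (∑ k, f k (s k)) ^ 4) ≤ 3 * n ^ 2 * c ^ 4 := by
  induction n with
  | zero => intro f _ _; simp [Ex]
  | succ n ih =>
    intro f h0 hb
    obtain ⟨i1, i2, i4⟩ := ih (fun k => f k.succ) (fun k => h0 _) (fun k a => hb _ a)
    set S : (Fin n → Fin N) → ℝ := fun s => ∑ k, f k.succ (s k) with hS
    have hf2 : ∀ a, f 0 a ^ 2 ≤ c ^ 2 := fun a => sq_le_sq' (abs_le.1 (hb 0 a)).1 (abs_le.1 (hb 0 a)).2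
    have hf4 : ∀ a, f 0 a ^ 4 ≤ c ^ 4 := fun a => by nlinarith [hf2 a, sq_nonneg (f 0 a), sq_nonneg c]
    have e2nn : 0 ≤ Ex w n (fun s => S s ^ 2) := Ex_nonneg w hw n _ fun s => sq_nonneg _
    refine ⟨?_, ?_, ?_⟩
    · rw [Ex_succ]
      simp only [Fin.sum_univ_succ, Fin.cons_zero, Fin.cons_succ]
      have : ∀ a, Ex w n (fun s => f 0 a + S s) = f 0 a := fun a => by
        rw [Ex_add, Ex_const w hw, i1, add_zero]
      simp only [hS] at this
      simp only [this, h0]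
    · rw [Ex_succ]
      simp only [Fin.sum_univ_succ, Fin.cons_zero, Fin.cons_succ]
      refine wavg_le w hw _ _ fun a => ?_
      have : Ex w n (fun s => (f 0 a + S s) ^ 2) = f 0 a ^ 2 + Ex w n (fun s => S s ^ 2) := by
        have e : (fun s => (f 0 a + S s) ^ 2) =
          (fun s => f 0 a ^ 2 + ((2 * f 0 a) * S s + S s ^ 2)) := by funext s; ring
        rw [e, Ex_add, Ex_add, Ex_const w hw, Ex_mul, i1]; ring
      simp only [hS] at this i2
      rw [this]; push_cast
      linarith [hf2 a]
    · rw [Ex_succ]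
      simp only [Fin.sum_univ_succ, Fin.cons_zero, Fin.cons_succ]
      have key : ∀ a, Ex w n (fun s => (f 0 a + S s) ^ 4) = f 0 a ^ 4 +
          6 * f 0 a ^ 2 * Ex w n (fun s => S s ^ 2) + 4 * f 0 a * Ex w n (fun s => S s ^ 3)
          + Ex w n (fun s => S s ^ 4) := by
        intro a
        have e : (fun s => (f 0 a + S s) ^ 4) =
          (fun s => f 0 a ^ 4 + ((4 * f 0 a ^ 3) * S s + ((6 * f 0 a ^ 2) * S s ^ 2 +
            ((4 * f 0 a) * S s ^ 3 + S s ^ 4)))) := by funext s; ring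
        rw [e, Ex_add, Ex_add, Ex_add, Ex_add, Ex_const w hw, Ex_mul, Ex_mul, Ex_mul, i1]; ring
      have key2 : ∑ a, w a * Ex w n (fun s => (f 0 a + S s) ^ 4) =
          ∑ a, w a * (f 0 a ^ 4 + 6 * f 0 a ^ 2 * Ex w n (fun s => S s ^ 2)
          + Ex w n (fun s => S s ^ 4)) := by
        have : ∑ a, w a * Ex w n (fun s => (f 0 a + S s) ^ 4) =
          ∑ a, w a * (f 0 a ^ 4 + 6 * f 0 a ^ 2 * Ex w n (fun s => S s ^ 2)
          + Ex w n (fun s => S s ^ 4)) + 4 * Ex w n (fun s => S s ^ 3) * ∑ a, w a * f 0 a := by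
          rw [Finset.mul_sum, ← Finset.sum_add_distrib]
          refine Finset.sum_congr rfl fun a _ => ?_
          rw [key]; ring
        rw [this, h0]; ring
      simp only [hS] at key2 i2 i4 e2nn
      rw [key2]
      refine wavg_le w hw _ _ fun a => ?_
      push_cast
      have := mul_le_mul (hf2 a) i2 e2nn (sq_nonneg c)
      nlinarith [hf4 a, pow_nonneg hc 4]

lemma Ex_diff4 {N : ℕ} (w : Fin N → ℝ) (hw : w ∈ stdSimplex ℝ (Fin N)) (t : ℝ) (ht : 0 ≤ t) (m n : ℕ)
    (hn : 0 < n) (hnm : n = 2 * m) (z : Fin N → ℝ) (hz : ∀ a, |z a| ≤ t) :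
    Ex w n (fun s => (∑ k ∈ Finset.range m, z (extSeq hn s k) -
      ∑ k ∈ Finset.range m, z (extSeq hn s (m + k))) ^ 4) ≤ 192 * t ^ 4 * m ^ 2 := by
  subst hnm
  set μ : ℝ := ∑ a, w a * z a with hμ
  have hμt : |μ| ≤ t := by
    rw [abs_le]
    constructor
    · have := wavg_le w hw (fun a => - z a) t (fun a => by linarith [(abs_le.1 (hz a)).1])
      simp only [mul_neg, Finset.sum_neg_distrib] at this
      linarith
    · exact wavg_le w hw z t (fun a => (abs_le.1 (hz a)).2)
  set f : Fin (2 * m) → Fin N → ℝ := fun k a => (if (k : ℕ) < m then 1 else -1) * (z a - μ) with hf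
  have h := (moments w hw (2 * t) (by linarith) (2 * m) f ?_ ?_).2.2
  · have e : ∀ s : Fin (2*m) → Fin N, ∑ k, f k (s k) = ∑ k ∈ Finset.range m, z (extSeq hn s k) -
      ∑ k ∈ Finset.range m, z (extSeq hn s (m + k)) := by
      intro s
      have e1 : ∀ k : Fin (2*m), f k (s k) =
        (fun k : ℕ => (if k < m then 1 else -1) * (z (extSeq hn s k) - μ)) k := by
        intro k; simp [hf, extSeq]
      rw [Finset.sum_congr rfl fun k _ => e1 k, Fin.sum_univ_eq_sum_range
        (fun k : ℕ => (if k < m then 1 else -1) * (z (extSeq hn s k) - μ)),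
        show Finset.range (2 * m) = Finset.range (m + m) by rw [two_mul],
        Finset.sum_range_add]
      have a1 : ∑ k ∈ Finset.range m, (if k < m then (1:ℝ) else -1) * (z (extSeq hn s k) - μ)
          = ∑ k ∈ Finset.range m, (z (extSeq hn s k) - μ) :=
        Finset.sum_congr rfl fun k hk => by rw [if_pos (Finset.mem_range.1 hk), one_mul]
      have a2 : ∑ k ∈ Finset.range m, (if m + k < m then (1:ℝ) else -1) * (z (extSeq hn s (m + k)) - μ)
          = ∑ k ∈ Finset.range m, -(z (extSeq hn s (m + k)) - μ) :=
        Finset.sum_congr rfl fun k hk => by rw [if_neg (by omega)]; ring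
      rw [a1, a2]
      simp only [Finset.sum_sub_distrib, Finset.sum_neg_distrib]
      ring
    simp only [e] at h
    refine h.trans (le_of_eq ?_)
    push_cast; ring
  · intro k
    have : ∑ a, w a * f k a = (if (k : ℕ) < m then 1 else -1) * ∑ a, w a * (z a - μ) := by
      rw [Finset.mul_sum]; exact Finset.sum_congr rfl fun a _ => by simp only [hf]; ring
    rw [this]
    simp only [mul_sub, Finset.sum_sub_distrib, ← Finset.sum_mul, hw.2, ← hμ]
    ring
  · intro k a
    simp only [hf, abs_mul]
    have : |(if (k : ℕ) < m then (1:ℝ) else -1)| = 1 := by split_ifs <;> simp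
    rw [this, one_mul]
    calc |z a - μ| ≤ |z a| + |μ| := abs_sub _ _
      _ ≤ 2 * t := by linarith [hz a]

lemma geomP_pos (k : ℕ) : 0 < geomP k := by
  have h8 : 1 < Real.sqrt 8 := by rw [Real.lt_sqrt] <;> norm_num
  have : (Real.sqrt 8)⁻¹ < 1 := inv_lt_one_of_one_lt₀ h8
  unfold geomP
  have : 0 < 1 - (Real.sqrt 8)⁻¹ := by linarith
  positivity

lemma geomP_hasSum : HasSum geomP 1 := by
  have h8 : 1 < Real.sqrt 8 := by rw [Real.lt_sqrt] <;> norm_num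
  have h1 : (Real.sqrt 8)⁻¹ < 1 := inv_lt_one_of_one_lt₀ h8
  have h := (hasSum_geometric_of_lt_one (r := (Real.sqrt 8)⁻¹) (by positivity) h1).mul_left
    (1 - (Real.sqrt 8)⁻¹)
  rwa [mul_inv_cancel₀ (by linarith)] at h

lemma geomP_inv (k : ℕ) : (geomP k)⁻¹ * ((4:ℝ) ^ k)⁻¹ ≤ 2 * (3 / 4) ^ k := by
  have h8 : 2 ≤ Real.sqrt 8 := by rw [Real.le_sqrt] <;> norm_num
  have h83 : Real.sqrt 8 ≤ 3 := by rw [Real.sqrt_le_left] <;> norm_num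
  have h1 : (Real.sqrt 8)⁻¹ ≤ 2⁻¹ := inv_anti₀ (by norm_num) h8
  have h2 : (1 - (Real.sqrt 8)⁻¹)⁻¹ ≤ 2 := by
    rw [inv_le_comm₀ (by linarith) (by norm_num)]; linarith
  unfold geomP
  rw [mul_inv, inv_pow, inv_inv, mul_assoc, ← div_eq_mul_inv, ← div_pow]
  gcongr

lemma mlmcSummand_eq {N M : ℕ} (w : Fin M → Fin N → ℝ) (i : Fin M)
    (F : ℕ → (ℕ → Fin N) → ℝ) (k : ℕ) :
    mlmcSummand w i F k = geomP k * Ex (w i) (2 ^ k) (fun s => F k (extSeq (Nat.two_pow_pos k) s)) :=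
  rfl

lemma mlmc_generic {d N M : ℕ} (w : Fin M → Fin N → ℝ) (i : Fin M)
    (hw : w i ∈ stdSimplex ℝ (Fin N)) (Y : ℕ → (ℕ → Fin N) → EuclideanSpace ℝ (Fin d))
    (a : EuclideanSpace ℝ (Fin d)) (q : ℕ → ℝ) (Q : ℝ) (hq : HasSum q Q)
    (hY : ∀ k, mlmcSummand w i (fun k s => ‖Y k s‖ ^ 2) k ≤ q k) :
    Summable (mlmcSummandVec w i (fun k s => a + Y k s)) ∧
    (∀ t : ℝ, 0 ≤ t → ‖∑' k, mlmcSummandVec w i (fun k s => a + Y k s) k - a‖ * t ≤ (t ^ 2 + Q) / 2) ∧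
    ∀ m, Summable (mlmcSummand w i (fun k s => ‖a + Y k s - m‖ ^ 2)) ∧
      ∑' k, mlmcSummand w i (fun k s => ‖a + Y k s - m‖ ^ 2) k ≤ 2 * Q + 2 * ‖m - a‖ ^ 2 := by
  have hvec : ∀ k, mlmcSummandVec w i (fun k s => a + Y k s) k
      = geomP k • a + mlmcSummandVec w i Y k := by
    intro k
    unfold mlmcSummandVec
    rw [← smul_add]
    congr 1
    simp only [smul_add, Finset.sum_add_distrib, ← Finset.sum_smul]
    have := Ex_const (w i) hw (2 ^ k) 1
    simp only [Ex, mul_one] at this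
    rw [this, one_smul]
  have hn : ∀ k, ‖mlmcSummandVec w i Y k‖ ≤ mlmcSummand w i (fun k s => ‖Y k s‖) k := by
    intro k
    unfold mlmcSummandVec mlmcSummand
    rw [norm_smul, Real.norm_of_nonneg (geomP_pos k).le]
    refine mul_le_mul_of_nonneg_left ?_ (geomP_pos k).le
    refine (norm_sum_le _ _).trans (Finset.sum_le_sum fun s _ => ?_)
    rw [norm_smul, Real.norm_of_nonneg (Finset.prod_nonneg fun k _ => hw.1 _)]
  have ht : ∀ t : ℝ, 0 ≤ t → ∀ k, ‖mlmcSummandVec w i Y k‖ * t ≤ (geomP k * t ^ 2 + q k) / 2 := by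
    intro t ht k
    refine (mul_le_mul_of_nonneg_right (hn k) ht).trans ?_
    have h1 : Ex (w i) (2 ^ k) (fun s => t * ‖Y k (extSeq (Nat.two_pow_pos k) s)‖) ≤
        Ex (w i) (2 ^ k) (fun s => t ^ 2 / 2 + (1 / 2) * ‖Y k (extSeq (Nat.two_pow_pos k) s)‖ ^ 2) :=
      Ex_mono _ hw _ _ _ fun s => by
        nlinarith [sq_nonneg (t - ‖Y k (extSeq (Nat.two_pow_pos k) s)‖)]
    rw [Ex_mul, Ex_add, Ex_const _ hw, Ex_mul] at h1
    have h2 := hY k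
    rw [mlmcSummand_eq] at h2 ⊢
    have h3 := mul_le_mul_of_nonneg_left h1 (geomP_pos k).le
    nlinarith
  have hsY : Summable (fun k => ‖mlmcSummandVec w i Y k‖) := by
    refine Summable.of_nonneg_of_le (fun k => norm_nonneg _) (fun k => ?_)
      ((geomP_hasSum.summable.add hq.summable).div_const 2)
    simpa using ht 1 zero_le_one k
  have hs1 : Summable (fun k => geomP k • a) := geomP_hasSum.summable.smul_const a
  refine ⟨?_, ?_, ?_⟩
  · rw [show mlmcSummandVec w i (fun k s => a + Y k s) = _ from funext hvec]
    exact hs1.add hsY.of_norm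
  · intro t h0
    simp only [hvec]
    rw [hs1.tsum_add hsY.of_norm, (geomP_hasSum.smul_const a).tsum_eq, one_smul, add_sub_cancel_left]
    refine (mul_le_mul_of_nonneg_right (norm_tsum_le_tsum_norm hsY) h0).trans ?_
    rw [← tsum_mul_right]
    have hh := ((geomP_hasSum.mul_right (t ^ 2)).add hq).div_const 2
    rw [one_mul] at hh
    rw [← hh.tsum_eq]
    exact (hsY.mul_right t).tsum_le_tsum (ht t h0) hh.summable
  · intro m
    have hb : ∀ k, mlmcSummand w i (fun k s => ‖a + Y k s - m‖ ^ 2) k ≤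
        2 * q k + geomP k * (2 * ‖m - a‖ ^ 2) := by
      intro k
      have h1 : Ex (w i) (2 ^ k) (fun s => ‖a + Y k (extSeq (Nat.two_pow_pos k) s) - m‖ ^ 2) ≤
        Ex (w i) (2 ^ k) (fun s => 2 * ‖Y k (extSeq (Nat.two_pow_pos k) s)‖ ^ 2 + 2 * ‖m - a‖ ^ 2) :=
        Ex_mono _ hw _ _ _ fun s => by
          set y := Y k (extSeq (Nat.two_pow_pos k) s)
          have e : a + y - m = y - (m - a) := by abel
          have := norm_sub_le y (m - a)
          rw [e]
          nlinarith [sq_nonneg (‖y‖ - ‖m - a‖), norm_nonneg (y - (m - a)), norm_nonneg y, norm_nonneg (m - a)]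
      rw [Ex_add, Ex_const _ hw, Ex_mul] at h1
      have h2 := hY k
      rw [mlmcSummand_eq] at h2 ⊢
      have h3 := mul_le_mul_of_nonneg_left h1 (geomP_pos k).le
      nlinarith
    have hh := (hq.mul_left 2).add (geomP_hasSum.mul_right (2 * ‖m - a‖ ^ 2))
    rw [one_mul] at hh
    have hs : Summable (mlmcSummand w i (fun k s => ‖a + Y k s - m‖ ^ 2)) := by
      refine Summable.of_nonneg_of_le (fun k => ?_) hb hh.summable
      rw [mlmcSummand_eq]
      exact mul_nonneg (geomP_pos k).le (Ex_nonneg _ hw _ _ fun s => by positivity)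
    refine ⟨hs, ?_⟩
    rw [← hh.tsum_eq]
    exact hs.tsum_le_tsum hb hh.summable

lemma exp_diff (B u v : ℝ) (hu : u ≤ B) (hv : v ≤ B) :
    |Real.exp u - Real.exp v| ≤ Real.exp B * |u - v| := by
  wlog h : v ≤ u generalizing u v
  · rw [abs_sub_comm, abs_sub_comm u v]
    exact this v u hv hu (by linarith)
  rw [abs_of_nonneg (by linarith [Real.exp_le_exp.2 h]), abs_of_nonneg (by linarith)]
  have h1 : Real.exp v = Real.exp u * Real.exp (v - u) := by rw [← Real.exp_add]; congr 1; ring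
  have h2 := Real.add_one_le_exp (v - u)
  have h3 := Real.exp_le_exp.2 hu
  have h4 := Real.exp_pos u
  calc Real.exp u - Real.exp v = Real.exp u * (1 - Real.exp (v - u)) := by rw [h1]; ring
    _ ≤ Real.exp u * (u - v) := mul_le_mul_of_nonneg_left (by linarith) h4.le
    _ ≤ Real.exp B * (u - v) := mul_le_mul_of_nonneg_right h3 (by linarith)

lemma exp_one_le3 : Real.exp 1 ≤ 3 := by linarith [Real.exp_one_lt_d9]

lemma exp_mid (κ α β : ℝ) (hκ : κ ≤ 1) (hα : α ≤ 2) (hβ : β ≤ 2) :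
    |Real.exp ((α + β) / 2 + κ) - (Real.exp (α + κ) + Real.exp (β + κ)) / 2| ≤ 4 * (α - β) ^ 2 := by
  have e : Real.exp ((α + β) / 2 + κ) - (Real.exp (α + κ) + Real.exp (β + κ)) / 2 =
      - (Real.exp κ / 2 * (Real.exp (α / 2) - Real.exp (β / 2)) ^ 2) := by
    have h1 : Real.exp ((α + β) / 2 + κ) = Real.exp (α / 2) * Real.exp (β / 2) * Real.exp κ := by
      rw [← Real.exp_add, ← Real.exp_add]; congr 1; ring
    have h2 : Real.exp (α + κ) = Real.exp (α / 2) * Real.exp (α / 2) * Real.exp κ := by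
      rw [← Real.exp_add, ← Real.exp_add]; congr 1; ring
    have h3 : Real.exp (β + κ) = Real.exp (β / 2) * Real.exp (β / 2) * Real.exp κ := by
      rw [← Real.exp_add, ← Real.exp_add]; congr 1; ring
    rw [h1, h2, h3]; ring
  rw [e, abs_neg, abs_of_nonneg (by positivity)]
  have hk : Real.exp κ ≤ 3 := (Real.exp_le_exp.2 hκ).trans exp_one_le3
  have hd : |Real.exp (α / 2) - Real.exp (β / 2)| ≤ 3 * |α / 2 - β / 2| :=
    (exp_diff 1 (α / 2) (β / 2) (by linarith) (by linarith)).trans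
      (mul_le_mul_of_nonneg_right exp_one_le3 (abs_nonneg _))
  have hd2 : (Real.exp (α / 2) - Real.exp (β / 2)) ^ 2 ≤ (3 * |α / 2 - β / 2|) ^ 2 := by
    rw [← sq_abs]; gcongr
  rw [mul_pow, sq_abs] at hd2
  calc Real.exp κ / 2 * (Real.exp (α / 2) - Real.exp (β / 2)) ^ 2
      ≤ 3 / 2 * (3 ^ 2 * (α / 2 - β / 2) ^ 2) := by gcongr
    _ ≤ 4 * (α - β) ^ 2 := by nlinarith [sq_nonneg (α - β)]

lemma avg_le (m : ℕ) (hm : 0 < m) (z : ℕ → ℝ) (B : ℝ) (h : ∀ k, z k ≤ B) :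
    (m : ℝ)⁻¹ * ∑ k ∈ Finset.range m, z k ≤ B := by
  have hm' : (0:ℝ) < m := by exact_mod_cast hm
  rw [inv_mul_le_iff₀ hm']
  calc _ ≤ ∑ k ∈ Finset.range m, B := Finset.sum_le_sum fun k _ => h k
    _ = m * B := by simp

lemma dHat_bound {d N : ℕ} (ℓ : Fin N → EuclideanSpace ℝ (Fin d) → ℝ) (ε' lam : ℝ) (hε : 0 < ε')
    (xbar x x' : EuclideanSpace ℝ (Fin d)) (m : ℕ) (hm : 0 < m) (s : ℕ → Fin N)
    (hz : ∀ j, |ℓ j x - ℓ j x'| ≤ 2 * ε') (hκ : lam / 2 * ‖x - xbar‖ ^ 2 ≤ ε') :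
    |dHat ℓ ε' lam xbar x x' m s| ≤ 4 * ε' * ((∑ k ∈ Finset.range m, (ℓ (s k) x - ℓ (s k) x') -
      ∑ k ∈ Finset.range m, (ℓ (s (m + k)) x - ℓ (s (m + k)) x')) / (m * ε')) ^ 2 := by
  have hm' : (0:ℝ) < m := by exact_mod_cast hm
  unfold dHat gammaHat
  set A := ∑ k ∈ Finset.range m, (ℓ (s k) x - ℓ (s k) x') with hA
  set B := ∑ k ∈ Finset.range m, (ℓ (s (m + k)) x - ℓ (s (m + k)) x') with hB
  set κ := lam / 2 * ‖x - xbar‖ ^ 2 with hκd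
  have hAB : ∑ k ∈ Finset.range (2 * m), (ℓ (s k) x - ℓ (s k) x') = A + B := by
    rw [two_mul, Finset.sum_range_add]
  rw [hAB]
  have h := exp_mid (κ / ε') ((m:ℝ)⁻¹ * A / ε') ((m:ℝ)⁻¹ * B / ε') ((div_le_one hε).2 hκ)
    ((div_le_iff₀ hε).2 (avg_le m hm _ _ fun k => (abs_le.1 (hz _)).2))
    ((div_le_iff₀ hε).2 (avg_le m hm _ _ fun k => (abs_le.1 (hz _)).2))
  have e1 : ((((2 * m : ℕ) : ℝ))⁻¹ * (A + B) + κ) / ε' =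
    ((m:ℝ)⁻¹ * A / ε' + (m:ℝ)⁻¹ * B / ε') / 2 + κ / ε' := by
    push_cast; field_simp
  rw [e1, add_div (_ * A) κ, add_div (_ * B) κ]
  have e2 : ∀ a b c : ℝ, ε' * a - (ε' * b + ε' * c) / 2 = ε' * (a - (b + c) / 2) := by intros; ring
  rw [e2, abs_mul, abs_of_pos hε]
  have e3 : (A - B) / (m * ε') = (m:ℝ)⁻¹ * A / ε' - (m:ℝ)⁻¹ * B / ε' := by field_simp
  rw [e3]
  calc _ ≤ ε' * _ := mul_le_mul_of_nonneg_left h hε.le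
    _ = _ := by ring

/-- second moment of the correction term -/
lemma corr_bound {d N : ℕ} (w : Fin N → ℝ) (hw : w ∈ stdSimplex ℝ (Fin N))
    (ℓ : Fin N → EuclideanSpace ℝ (Fin d) → ℝ) (ε' lam T : ℝ) (hε : 0 < ε') (hT : 0 ≤ T)
    (hT2 : T ≤ 2 * ε')
    (xbar x x' : EuclideanSpace ℝ (Fin d)) (k : ℕ)
    (hz : ∀ j, |ℓ j x - ℓ j x'| ≤ T) (hκ : lam / 2 * ‖x - xbar‖ ^ 2 ≤ ε') :
    geomP k * Ex w (2 ^ k) (fun s => ((if k = 0 then 0 else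
      dHat ℓ ε' lam xbar x x' (2 ^ (k - 1)) (extSeq (Nat.two_pow_pos k) s)) / geomP k) ^ 2)
      ≤ 98304 * T ^ 2 * (3 / 4) ^ k := by
  rcases Nat.eq_zero_or_pos k with h0 | h0
  · subst h0
    simp only [if_true, zero_div]
    rw [Ex_const _ hw]
    simp; positivity
  have hk : k ≠ 0 := h0.ne'
  simp only [hk, if_false]
  set m := 2 ^ (k - 1) with hm
  have hmpos : 0 < m := Nat.two_pow_pos _
  have hm' : (0:ℝ) < m := by exact_mod_cast hmpos
  have h2m : 2 ^ k = 2 * m := by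
    rw [hm, ← pow_succ']; congr 1; omega
  have hm4 : (4:ℝ) * (m:ℝ) ^ 2 = 4 ^ k := by
    have : ((2:ℝ) ^ k) = 2 * m := by exact_mod_cast h2m
    calc (4:ℝ) * (m:ℝ) ^ 2 = (2 * m) ^ 2 := by ring
      _ = (2 ^ k) ^ 2 := by rw [this]
      _ = 4 ^ k := by rw [← pow_mul, mul_comm, pow_mul]; norm_num
  have h4 := Ex_diff4 w hw T hT m (2 ^ k) (Nat.two_pow_pos k) h2m (fun j => ℓ j x - ℓ j x') hz
  have h5 : Ex w (2 ^ k) (fun s => (dHat ℓ ε' lam xbar x x' m (extSeq (Nat.two_pow_pos k) s) / geomP k) ^ 2)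
      ≤ Ex w (2 ^ k) (fun s => (16 / (ε' ^ 2 * m ^ 4) * ((geomP k)⁻¹) ^ 2) *
        (∑ l ∈ Finset.range m, (ℓ (extSeq (Nat.two_pow_pos k) s l) x - ℓ (extSeq (Nat.two_pow_pos k) s l) x') -
      ∑ l ∈ Finset.range m, (ℓ (extSeq (Nat.two_pow_pos k) s (m + l)) x - ℓ (extSeq (Nat.two_pow_pos k) s (m + l)) x')) ^ 4) := by
    refine Ex_mono _ hw _ _ _ fun s => ?_
    have hb := dHat_bound ℓ ε' lam hε xbar x x' m hmpos (extSeq (Nat.two_pow_pos k) s)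
      (fun j => (hz j).trans hT2) hκ
    set X := (∑ l ∈ Finset.range m, (ℓ (extSeq (Nat.two_pow_pos k) s l) x - ℓ (extSeq (Nat.two_pow_pos k) s l) x') -
      ∑ l ∈ Finset.range m, (ℓ (extSeq (Nat.two_pow_pos k) s (m + l)) x - ℓ (extSeq (Nat.two_pow_pos k) s (m + l)) x'))
    set D := dHat ℓ ε' lam xbar x x' m (extSeq (Nat.two_pow_pos k) s)
    have hD : D ^ 2 ≤ (4 * ε' * (X / (m * ε')) ^ 2) ^ 2 := by
      rw [← sq_abs D]; gcongr
    calc (D / geomP k) ^ 2 = D ^ 2 * (geomP k)⁻¹ ^ 2 := by rw [div_eq_mul_inv, mul_pow]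
      _ ≤ (4 * ε' * (X / (m * ε')) ^ 2) ^ 2 * (geomP k)⁻¹ ^ 2 := by gcongr
      _ = _ := by field_simp; ring
  rw [Ex_mul] at h5
  have hp := geomP_pos k
  have hpi := geomP_inv k
  have hT4 : T ^ 4 ≤ 4 * ε' ^ 2 * T ^ 2 := by
    have : T ^ 2 ≤ (2 * ε') ^ 2 := by gcongr
    nlinarith [sq_nonneg T]
  calc _ ≤ geomP k * ((16 / (ε' ^ 2 * m ^ 4) * ((geomP k)⁻¹) ^ 2) * (192 * T ^ 4 * m ^ 2)) := by
        refine mul_le_mul_of_nonneg_left (h5.trans ?_) hp.le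
        exact mul_le_mul_of_nonneg_left h4 (by positivity)
    _ = 12288 / ε' ^ 2 * T ^ 4 * ((geomP k)⁻¹ * ((4:ℝ) ^ k)⁻¹) := by
        rw [← hm4]; field_simp; ring
    _ ≤ 12288 / ε' ^ 2 * (4 * ε' ^ 2 * T ^ 2) * (2 * (3 / 4) ^ k) := by
        gcongr
    _ = _ := by field_simp; ring

lemma Y_bound {d : ℕ} (g g' : EuclideanSpace ℝ (Fin d)) (G ε' Mc γ v T D : ℝ) (_ : 0 < G) (hε : 0 < ε')
    (hT : 0 ≤ T)
    (hMc0 : 0 ≤ Mc) (hMc : Mc ≤ 3) (hγ0 : 0 ≤ γ) (hγ : γ ≤ 3 * ε') (hg : ‖g‖ ≤ 2 * G)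
    (hv : |v - γ| ≤ 54 * T + |D|) :
    ‖(Mc / ε') • (v • g - γ • g')‖ ^ 2 ≤
      419904 * (G * T / ε') ^ 2 + 162 * ‖g - g'‖ ^ 2 + 144 * (G / ε') ^ 2 * D ^ 2 := by
  have e : v • g - γ • g' = (v - γ) • g + γ • (g - g') := by module
  have h1 : ‖(Mc / ε') • (v • g - γ • g')‖ ≤ 3 / ε' * ((54 * T + |D|) * (2 * G) + 3 * ε' * ‖g - g'‖) := by
    rw [norm_smul, Real.norm_of_nonneg (by positivity), e]
    refine mul_le_mul (by gcongr) ?_ (norm_nonneg _) (by positivity)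
    refine (norm_add_le _ _).trans ?_
    rw [norm_smul, norm_smul, Real.norm_of_nonneg hγ0, Real.norm_eq_abs]
    refine add_le_add (mul_le_mul hv hg (norm_nonneg _) (by positivity)) (by gcongr)
  have h2 : 3 / ε' * ((54 * T + |D|) * (2 * G) + 3 * ε' * ‖g - g'‖) =
      324 * (G * T / ε') + 6 * (G / ε' * |D|) + 9 * ‖g - g'‖ := by
    field_simp; ring
  rw [h2] at h1
  set a := G * T / ε'
  set b := G / ε' * |D| with hb
  set c := ‖g - g'‖
  have hbb : 144 * (G / ε') ^ 2 * D ^ 2 = 144 * b ^ 2 := by rw [hb, mul_pow, sq_abs]; ring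
  rw [hbb]
  calc _ ≤ (324 * a + 6 * b + 9 * c) ^ 2 := by gcongr
    _ ≤ _ := by nlinarith [sq_nonneg (324 * a - 6 * b), sq_nonneg (324 * a + 6 * b - 9 * c)]

lemma group_le {d N M : ℕ} (w : Fin M → Fin N → ℝ) (hw : ∀ i, w i ∈ stdSimplex ℝ (Fin N))
    (ℓ : Fin N → EuclideanSpace ℝ (Fin d) → ℝ) (i : Fin M) (z z' : EuclideanSpace ℝ (Fin d)) (B : ℝ)
    (h : ∀ j, |ℓ j z - ℓ j z'| ≤ B) : groupLoss w ℓ i z ≤ groupLoss w ℓ i z' + B := by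
  have := wavg_le (w i) (hw i) (fun j => ℓ j z - ℓ j z') B (fun j => (abs_le.1 (h j)).2)
  simp only [mul_sub, Finset.sum_sub_distrib] at this
  unfold groupLoss
  linarith

lemma grad_le {d : ℕ} (f : EuclideanSpace ℝ (Fin d) → ℝ) (g z : EuclideanSpace ℝ (Fin d)) (G : ℝ)
    (hG : 0 < G) (h : HasGradientAt f g z) (hl : ∀ z z', |f z - f z'| ≤ G * ‖z - z'‖) : ‖g‖ ≤ G := by
  have h1 : HasFDerivAt f _ z := h.hasFDerivAt
  have h2 : LipschitzWith ⟨G, hG.le⟩ f := LipschitzWith.of_dist_le_mul fun a b => by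
    rw [Real.dist_eq, dist_eq_norm]; exact hl a b
  have := h1.le_of_lipschitz h2
  rw [LinearIsometryEquiv.norm_map] at this
  exact this

lemma mlmcVal_bound {d N : ℕ} (ℓ : Fin N → EuclideanSpace ℝ (Fin d) → ℝ) (ε' lam T : ℝ) (hε : 0 < ε')
    (hT2 : T ≤ 2 * ε')
    (xbar x x' : EuclideanSpace ℝ (Fin d)) (k : ℕ) (s : ℕ → Fin N)
    (hz : ∀ j, |ℓ j x - ℓ j x'| ≤ T) (hκ : lam / 2 * ‖x - xbar‖ ^ 2 ≤ ε')
    (hκ' : lam / 2 * ‖x' - xbar‖ ^ 2 ≤ ε')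
    (hd : |lam / 2 * ‖x - xbar‖ ^ 2 - lam / 2 * ‖x' - xbar‖ ^ 2| ≤ T) :
    |mlmcVal ℓ ε' lam xbar x x' k s - ε' * Real.exp ((lam / 2 * ‖x' - xbar‖ ^ 2) / ε')| ≤
      54 * T + |(if k = 0 then 0 else dHat ℓ ε' lam xbar x x' (2 ^ (k - 1)) s) / geomP k| := by
  unfold mlmcVal
  rw [add_sub_right_comm]
  refine (abs_add_le _ _).trans (add_le_add_left ?_ _)
  unfold gammaHat
  simp only [Nat.cast_one, inv_one, one_mul, Finset.sum_range_one]
  rw [← mul_sub, abs_mul, abs_of_pos hε]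
  have hz0 := hz (s 0)
  set u := ℓ (s 0) x - ℓ (s 0) x'
  set a := lam / 2 * ‖x - xbar‖ ^ 2
  set b := lam / 2 * ‖x' - xbar‖ ^ 2
  have hu := abs_le.1 hz0
  have h1 := exp_diff 3 ((u + a) / ε') (b / ε') (by rw [div_le_iff₀ hε]; linarith)
    (by rw [div_le_iff₀ hε]; linarith)
  have h27 : Real.exp 3 ≤ 27 := by
    have : Real.exp 3 = Real.exp 1 ^ 3 := by rw [← Real.exp_nat_mul]; norm_num
    rw [this]
    calc Real.exp 1 ^ 3 ≤ 3 ^ 3 := by gcongr; exact exp_one_le3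
      _ = 27 := by norm_num
  have h2 : |(u + a) / ε' - b / ε'| ≤ 2 * T / ε' := by
    rw [← sub_div, abs_div, abs_of_pos hε]
    gcongr
    have := abs_add_le u (a - b)
    rw [← add_sub_assoc] at this
    linarith
  calc _ ≤ ε' * (27 * (2 * T / ε')) := by
        refine mul_le_mul_of_nonneg_left (h1.trans ?_) hε.le
        exact mul_le_mul h27 h2 (abs_nonneg _) (by norm_num)
    _ = 54 * T := by field_simp; ring

set_option maxHeartbeats 2000000 in
/-- Under mean-square smoothness
`Σ_j w_{ij} ‖∇ℓ_j(x) − ∇ℓ_j(x')‖² ≤ L²‖x − x'‖²` on `B_r(x̄) ∩ 𝒳`, `r = ε'/G`, `0 < λ ≤ G/r`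
and `x, x' ∈ B_r(x̄) ∩ 𝒳`, the SVRG-like estimator `ĝ_{x'}(x)` satisfies
`Var(ĝ_{x'}(x)) = E‖ĝ_{x'}(x) − E ĝ_{x'}(x)‖² ≤ C (L + λ + G²/ε')² ‖x − x'‖²`
for an absolute constant `C`. -/
theorem stmt6 :
    ∃ C : ℝ, 0 < C ∧
    ∀ (d N M : ℕ) (_ : 2 ≤ M)
      (𝒳 : Set (EuclideanSpace ℝ (Fin d))) (_ : Convex ℝ 𝒳) (_ : IsClosed 𝒳)
      (ℓ : Fin N → EuclideanSpace ℝ (Fin d) → ℝ)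
      (gradℓ : Fin N → EuclideanSpace ℝ (Fin d) → EuclideanSpace ℝ (Fin d))
      (w : Fin M → Fin N → ℝ) (_ : ∀ i, w i ∈ stdSimplex ℝ (Fin N))
      (G ε ε' lam r L : ℝ) (_ : 0 < G) (_ : 0 < ε)
      (_ : ε' = ε / (2 * Real.log (M : ℝ)))
      (_ : ∀ j, ConvexOn ℝ 𝒳 (ℓ j))
      (_ : ∀ j z, HasGradientAt (ℓ j) (gradℓ j z) z)
      (_ : ∀ j (z z' : EuclideanSpace ℝ (Fin d)), |ℓ j z - ℓ j z'| ≤ G * ‖z - z'‖)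
      (_ : 0 ≤ L)
      (_ : r = ε' / G) (_ : 0 < lam) (_ : lam ≤ G / r)
      (xbar : EuclideanSpace ℝ (Fin d)) (_ : xbar ∈ 𝒳)
      (_ : ∀ i, ∀ z ∈ Metric.closedBall xbar r ∩ 𝒳, ∀ z' ∈ Metric.closedBall xbar r ∩ 𝒳,
        (∑ j, w i j * ‖gradℓ j z - gradℓ j z'‖ ^ 2) ≤ L ^ 2 * ‖z - z'‖ ^ 2)
      (x x' : EuclideanSpace ℝ (Fin d))
      (_ : x ∈ Metric.closedBall xbar r ∩ 𝒳) (_ : x' ∈ Metric.closedBall xbar r ∩ 𝒳),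
      let pbar : Fin M → ℝ := fun i =>
        Real.exp (groupLoss w ℓ i xbar / ε') / ∑ k, Real.exp (groupLoss w ℓ k xbar / ε')
      let pX : Fin M → ℝ := fun i =>
        Real.exp (groupLoss w ℓ i x' / ε') / ∑ k, Real.exp (groupLoss w ℓ k x' / ε')
      let Mc : ℝ :=
        (∑ k, Real.exp (groupLoss w ℓ k x' / ε')) / ∑ k, Real.exp (groupLoss w ℓ k xbar / ε')
      let γfun : Fin M → EuclideanSpace ℝ (Fin d) → ℝ := fun i z =>
        ε' * Real.exp ((groupLoss w ℓ i z - groupLoss w ℓ i xbar + lam / 2 * ‖z - xbar‖ ^ 2) / ε')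
      let gradGamma : EuclideanSpace ℝ (Fin d) → EuclideanSpace ℝ (Fin d) := fun z =>
        ∑ i, pbar i • ((γfun i z / ε') • ((∑ j, w i j • gradℓ j z) + lam • (z - xbar)))
      let estVec : Fin M → Fin N → ℕ → (ℕ → Fin N) → EuclideanSpace ℝ (Fin d) :=
        fun _i j k s =>
          gradGamma x' + (Mc / ε') •
            ((mlmcVal ℓ ε' lam xbar x x' k s) • (gradℓ j x + lam • (x - xbar)) -
              (ε' * Real.exp ((lam / 2 * ‖x' - xbar‖ ^ 2) / ε')) •
                (gradℓ j x' + lam • (x' - xbar)))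
      let mean : EuclideanSpace ℝ (Fin d) :=
        ∑ i, pX i • ∑ j, w i j • ∑' k, mlmcSummandVec w i (estVec i j) k
      (∀ i j, Summable (mlmcSummandVec w i (estVec i j))) ∧
      (∀ i j, Summable (mlmcSummand w i (fun k s => ‖estVec i j k s - mean‖ ^ 2))) ∧
      (∑ i, pX i * ∑ j, w i j *
          ∑' k, mlmcSummand w i (fun k s => ‖estVec i j k s - mean‖ ^ 2) k)
        ≤ C * (L + lam + G ^ 2 / ε') ^ 2 * ‖x - x'‖ ^ 2 := by
  refine ⟨1000000000, by norm_num, ?_⟩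
  intro d N M hM 𝒳 _ _ ℓ gradℓ w hw G ε ε' lam r L hG hε0 hε'd _ hgrad hlip hL hr hlam hlamr
    xbar _ hms x x' hx hx' pbar pX Mc γfun gradGamma estVec mean
  have hε : 0 < ε' := by
    have : 0 < Real.log (M : ℝ) := Real.log_pos (by exact_mod_cast hM)
    rw [hε'd]; positivity
  have hrpos : 0 < r := by rw [hr]; positivity
  have hGr : G * r = ε' := by rw [hr]; field_simp
  have hlr : lam * r ≤ G := by rwa [le_div_iff₀ hrpos] at hlamr
  have hxr : ‖x - xbar‖ ≤ r := by simpa [dist_eq_norm] using hx.1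
  have hxr' : ‖x' - xbar‖ ≤ r := by simpa [dist_eq_norm] using hx'.1
  set Δ := ‖x - x'‖ with hΔ
  have hΔ0 : 0 ≤ Δ := norm_nonneg _
  have hΔr : Δ ≤ 2 * r := by
    have : x - x' = (x - xbar) - (x' - xbar) := by abel
    rw [hΔ, this]
    linarith [norm_sub_le (x - xbar) (x' - xbar)]
  set T := G * Δ with hTd
  have hT : 0 ≤ T := by positivity
  have hT2 : T ≤ 2 * ε' := by rw [← hGr, hTd]; nlinarith
  have hz : ∀ j, |ℓ j x - ℓ j x'| ≤ T := fun j => hlip j x x'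
  have hkap : ∀ y : EuclideanSpace ℝ (Fin d), ‖y - xbar‖ ≤ r → lam / 2 * ‖y - xbar‖ ^ 2 ≤ ε' := by
    intro y hy
    calc lam / 2 * ‖y - xbar‖ ^ 2 ≤ lam / 2 * r ^ 2 := by gcongr
      _ ≤ ε' := by rw [← hGr]; nlinarith
  have hd : |lam / 2 * ‖x - xbar‖ ^ 2 - lam / 2 * ‖x' - xbar‖ ^ 2| ≤ T := by
    have e : lam / 2 * ‖x - xbar‖ ^ 2 - lam / 2 * ‖x' - xbar‖ ^ 2 =
      (‖x - xbar‖ - ‖x' - xbar‖) * (lam / 2 * (‖x - xbar‖ + ‖x' - xbar‖)) := by ring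
    have h1 : |‖x - xbar‖ - ‖x' - xbar‖| ≤ Δ := by
      have := abs_norm_sub_norm_le (x - xbar) (x' - xbar)
      rwa [sub_sub_sub_cancel_right] at this
    have h2 : lam / 2 * (‖x - xbar‖ + ‖x' - xbar‖) ≤ G := by nlinarith
    rw [e, abs_mul, abs_of_nonneg (a := lam / 2 * _) (by positivity), hTd, mul_comm G]
    exact mul_le_mul h1 h2 (by positivity) hΔ0
  have hg : ∀ j, ‖gradℓ j x + lam • (x - xbar)‖ ≤ 2 * G := by
    intro j
    refine (norm_add_le _ _).trans ?_
    rw [norm_smul, Real.norm_of_nonneg hlam.le]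
    have := grad_le (ℓ j) _ x G hG (hgrad j x) (hlip j)
    nlinarith
  have hMne : Nonempty (Fin M) := ⟨⟨0, by omega⟩⟩
  have hden : ∀ y, 0 < ∑ k, Real.exp (groupLoss w ℓ k y / ε') := fun y =>
    Finset.sum_pos (fun k _ => Real.exp_pos _) Finset.univ_nonempty
  have hMc0 : 0 ≤ Mc := div_nonneg (hden _).le (hden _).le
  have hMc : Mc ≤ 3 := by
    refine (div_le_iff₀ (hden _)).2 ?_
    rw [Finset.mul_sum]
    refine Finset.sum_le_sum fun k _ => ?_
    have h1 := group_le w hw ℓ k x' xbar ε' (fun j => (hlip j x' xbar).trans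
      (by rw [← hGr]; gcongr))
    calc Real.exp (groupLoss w ℓ k x' / ε') ≤ Real.exp (1 + groupLoss w ℓ k xbar / ε') := by
          refine Real.exp_le_exp.2 ?_
          rw [div_le_iff₀ hε, add_mul, div_mul_cancel₀ _ hε.ne']
          linarith
      _ ≤ _ := by rw [Real.exp_add]; gcongr; exact exp_one_le3
  have hpX : pX ∈ stdSimplex ℝ (Fin M) := by
    refine ⟨fun i => div_nonneg (Real.exp_pos _).le (hden _).le, ?_⟩
    simp only [pX]
    rw [← Finset.sum_div, div_self (hden _).ne']
  set γ : ℝ := ε' * Real.exp ((lam / 2 * ‖x' - xbar‖ ^ 2) / ε') with hγd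
  have hγ0 : 0 ≤ γ := by positivity
  have hγ : γ ≤ 3 * ε' := by
    rw [hγd, mul_comm 3]
    gcongr
    exact (Real.exp_le_exp.2 ((div_le_one hε).2 (hkap x' hxr'))).trans exp_one_le3
  set a := gradGamma x' with had
  set H := (G * T / ε') ^ 2 with hHd
  set δ : Fin N → ℝ := fun j =>
    ‖(gradℓ j x + lam • (x - xbar)) - (gradℓ j x' + lam • (x' - xbar))‖ ^ 2 with hδd
  let Y : Fin N → ℕ → (ℕ → Fin N) → EuclideanSpace ℝ (Fin d) := fun j k s =>
    (Mc / ε') • ((mlmcVal ℓ ε' lam xbar x x' k s) • (gradℓ j x + lam • (x - xbar)) -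
              γ • (gradℓ j x' + lam • (x' - xbar)))
  let q : Fin N → ℕ → ℝ := fun j k =>
    geomP k * (419904 * H + 162 * δ j) + 144 * 98304 * H * (3 / 4) ^ k
  let Q : Fin N → ℝ := fun j => (419904 * H + 162 * δ j) + 144 * 98304 * H * 4
  have hq : ∀ j, HasSum (q j) (Q j) := by
    intro j
    have h1 := geomP_hasSum.mul_right (419904 * H + 162 * δ j)
    rw [one_mul] at h1
    have h2 := (hasSum_geometric_of_lt_one (r := (3 / 4 : ℝ)) (by norm_num) (by norm_num)).mul_left
      (144 * 98304 * H)
    rw [show ((1 - 3 / 4 : ℝ))⁻¹ = 4 by norm_num] at h2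
    exact h1.add h2
  have hY : ∀ i j k, mlmcSummand w i (fun k s => ‖Y j k s‖ ^ 2) k ≤ q j k := by
    intro i j k
    rw [mlmcSummand_eq]
    have h1 := Ex_mono (w i) (hw i) (2 ^ k)
      (fun s => ‖Y j k (extSeq (Nat.two_pow_pos k) s)‖ ^ 2)
      (fun s => (419904 * H + 162 * δ j) + (144 * (G / ε') ^ 2) * ((if k = 0 then 0 else
      dHat ℓ ε' lam xbar x x' (2 ^ (k - 1)) (extSeq (Nat.two_pow_pos k) s)) / geomP k) ^ 2)
      (fun s => Y_bound _ _ G ε' Mc γ _ T _ hG hε hT hMc0 hMc hγ0 hγ (hg j)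
        (mlmcVal_bound ℓ ε' lam T hε hT2 xbar x x' k _ hz (hkap x hxr) (hkap x' hxr') hd))
    rw [Ex_add, Ex_const _ (hw i), Ex_mul] at h1
    have h2 := corr_bound (w i) (hw i) ℓ ε' lam T hε hT hT2 xbar x x' k hz (hkap x hxr)
    have h3 := mul_le_mul_of_nonneg_left h1 (geomP_pos k).le
    have h4 := mul_le_mul_of_nonneg_left h2 (show 0 ≤ 144 * (G / ε') ^ 2 by positivity)
    have h5 : 144 * (G / ε') ^ 2 * (98304 * T ^ 2 * (3 / 4) ^ k) =
      144 * 98304 * H * (3 / 4) ^ k := by rw [hHd]; ring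
    simp only [q]
    linarith
  have gen := fun i j => mlmc_generic w i (hw i) (Y j) a (q j) (Q j) (hq j) (hY i j)
  have hest : ∀ i j, estVec i j = fun k s => a + Y j k s := fun i j => rfl
  set A := L + lam + G ^ 2 / ε' with hAd
  have hQ : ∀ i, ∑ j, w i j * Q j ≤ 100000000 * A ^ 2 * Δ ^ 2 := by
    intro i
    have e : ∑ j, w i j * Q j = (419904 + 144 * 98304 * 4) * H + 162 * ∑ j, w i j * δ j := by
      have : ∀ j, w i j * Q j = w i j * ((419904 + 144 * 98304 * 4) * H) + 162 * (w i j * δ j) := by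
        intro j; simp only [Q]; ring
      simp only [this]
      rw [Finset.sum_add_distrib, ← Finset.sum_mul, (hw i).2, one_mul, Finset.mul_sum]
    have h1 : ∑ j, w i j * δ j ≤ 2 * (L ^ 2 * Δ ^ 2) + 2 * (lam * Δ) ^ 2 := by
      have h2 : ∀ j, δ j ≤ 2 * ‖gradℓ j x - gradℓ j x'‖ ^ 2 + 2 * (lam * Δ) ^ 2 := by
        intro j
        have e1 : (gradℓ j x + lam • (x - xbar)) - (gradℓ j x' + lam • (x' - xbar)) =
          (gradℓ j x - gradℓ j x') + lam • (x - x') := by module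
        have h3 := norm_add_le (gradℓ j x - gradℓ j x') (lam • (x - x'))
        rw [norm_smul, Real.norm_of_nonneg hlam.le, ← hΔ] at h3
        simp only [hδd]
        rw [e1]
        calc _ ≤ (‖gradℓ j x - gradℓ j x'‖ + lam * Δ) ^ 2 := by gcongr
          _ ≤ _ := by nlinarith [sq_nonneg (‖gradℓ j x - gradℓ j x'‖ - lam * Δ)]
      calc ∑ j, w i j * δ j
          ≤ ∑ j, w i j * (2 * ‖gradℓ j x - gradℓ j x'‖ ^ 2 + 2 * (lam * Δ) ^ 2) :=
            Finset.sum_le_sum fun j _ => mul_le_mul_of_nonneg_left (h2 j) ((hw i).1 j)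
        _ = 2 * ∑ j, w i j * ‖gradℓ j x - gradℓ j x'‖ ^ 2 + 2 * (lam * Δ) ^ 2 := by
            simp only [mul_add, Finset.sum_add_distrib, ← Finset.sum_mul, (hw i).2, one_mul]
            rw [Finset.mul_sum]
            congr 1
            exact Finset.sum_congr rfl fun j _ => by ring
        _ ≤ _ := by
            have := hms i x hx x' hx'
            linarith
    have hH : H = (G ^ 2 / ε') ^ 2 * Δ ^ 2 := by rw [hHd, hTd]; ring
    rw [e, hH]
    have hP : 0 ≤ G ^ 2 / ε' := by positivity
    set P := G ^ 2 / ε'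
    have hA2 : L ^ 2 + lam ^ 2 + P ^ 2 ≤ A ^ 2 := by
      rw [hAd]
      nlinarith [mul_nonneg hL hlam.le, mul_nonneg hL hP, mul_nonneg hlam.le hP]
    have hD2 := sq_nonneg Δ
    have hm := mul_le_mul_of_nonneg_right hA2 hD2
    nlinarith [mul_nonneg (sq_nonneg L) hD2, mul_nonneg (sq_nonneg lam) hD2,
      mul_nonneg (sq_nonneg P) hD2]
  set R := 100000000 * A ^ 2 * Δ ^ 2 with hR
  have hmean : ‖mean - a‖ ^ 2 ≤ R := by
    set V : Fin M → Fin N → EuclideanSpace ℝ (Fin d) := fun i j =>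
      ∑' k, mlmcSummandVec w i (estVec i j) k with hV
    have e : mean - a = ∑ i, pX i • ∑ j, w i j • (V i j - a) := by
      simp only [smul_sub, Finset.sum_sub_distrib, ← Finset.sum_smul, (hw _).2, one_smul, hpX.2]
      rfl
    set t := ‖mean - a‖ with ht
    have h0 : 0 ≤ t := norm_nonneg _
    have h1 : t ≤ ∑ i, pX i * ∑ j, w i j * ‖V i j - a‖ := by
      rw [ht, e]
      refine (norm_sum_le _ _).trans (Finset.sum_le_sum fun i _ => ?_)
      rw [norm_smul, Real.norm_of_nonneg (hpX.1 i)]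
      refine mul_le_mul_of_nonneg_left ?_ (hpX.1 i)
      refine (norm_sum_le _ _).trans (Finset.sum_le_sum fun j _ => ?_)
      rw [norm_smul, Real.norm_of_nonneg ((hw i).1 j)]
    have h2 : (∑ i, pX i * ∑ j, w i j * ‖V i j - a‖) * t ≤ (t ^ 2 + R) / 2 := by
      rw [Finset.sum_mul]
      simp only [mul_assoc]
      refine wavg_le pX hpX _ _ fun i => ?_
      rw [Finset.sum_mul]
      calc _ ≤ ∑ j, w i j * ((t ^ 2 + Q j) / 2) := by
            refine Finset.sum_le_sum fun j _ => ?_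
            rw [mul_assoc]
            exact mul_le_mul_of_nonneg_left ((gen i j).2.1 t h0) ((hw i).1 j)
        _ = (t ^ 2 + ∑ j, w i j * Q j) / 2 := by
            simp only [add_div, mul_add, Finset.sum_add_distrib, ← Finset.sum_mul, (hw i).2,
              one_mul, Finset.sum_div, mul_div_assoc]
        _ ≤ _ := by linarith [hQ i]
    have h3 := mul_le_mul_of_nonneg_right h1 h0
    rw [← sq] at h3
    linarith
  refine ⟨fun i j => (gen i j).1, fun i j => ((gen i j).2.2 mean).1, ?_⟩
  have hfin : (∑ i, pX i * ∑ j, w i j *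
          ∑' k, mlmcSummand w i (fun k s => ‖estVec i j k s - mean‖ ^ 2) k) ≤ 4 * R := by
    refine wavg_le pX hpX _ _ fun i => ?_
    calc _ ≤ ∑ j, w i j * (2 * Q j + 2 * ‖mean - a‖ ^ 2) :=
          Finset.sum_le_sum fun j _ =>
            mul_le_mul_of_nonneg_left ((gen i j).2.2 mean).2 ((hw i).1 j)
      _ = 2 * ∑ j, w i j * Q j + 2 * ‖mean - a‖ ^ 2 := by
          simp only [mul_add, Finset.sum_add_distrib, ← Finset.sum_mul, (hw i).2, one_mul]
          rw [Finset.mul_sum]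
          congr 1
          exact Finset.sum_congr rfl fun j _ => by ring
      _ ≤ 4 * R := by linarith [hQ i]
  refine hfin.trans ?_
  rw [hR]
  nlinarith [mul_nonneg (sq_nonneg A) (sq_nonneg Δ)]
end
end

section
/- Let ψ : [0,∞) → ℝ be convex, G > 0, N ≥ 1, and c ∈ ℝ^N. Then sup_{q ∈ Δ^N} Σ_{i∈[N]} ( q_i c_i − ψ(q_i) ) = inf_{y ∈ ℝ} [ Σ_{i∈[N]} ψ*(c_i − G y) + G y ], where the right-hand side takes values in ℝ ∪ {+∞}; in particular the infimum is finite and equals the (finite) left-hand side. -/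
theorem aux_cvx (ψ : ℝ → ℝ) (hψ : ConvexOn ℝ (Set.Ici 0) ψ) (x y a b : ℝ) (hx : 0 ≤ x)
    (hy : 0 ≤ y) (ha : 0 ≤ a) (hb : 0 ≤ b) (hab : a + b = 1) :
    ψ (a * x + b * y) ≤ a * ψ x + b * ψ y := by
  have h := hψ.2 (Set.mem_Ici.2 hx) (Set.mem_Ici.2 hy) ha hb hab
  simpa only [smul_eq_mul] using h

theorem aux_sup {N : ℕ} (g : Fin N → Set.Ici (0 : ℝ) → ℝ) (B : ℝ)
    (h : ∀ q : Fin N → Set.Ici (0 : ℝ), ∑ i, g i (q i) ≤ B) :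
    (∑ i, ⨆ t : Set.Ici (0 : ℝ), ((g i t : ℝ) : EReal)) ≤ (B : EReal) := by
  classical
  have hbdd : ∀ i, BddAbove (Set.range (g i)) := by
    intro i
    let z : Set.Ici (0 : ℝ) := ⟨0, Set.mem_Ici.2 le_rfl⟩
    refine ⟨B - ∑ j ∈ Finset.univ.erase i, g j z, ?_⟩
    rintro _ ⟨t, rfl⟩
    have h1 := h (Function.update (fun _ => z) i t)
    rw [← Finset.add_sum_erase _ _ (Finset.mem_univ i)] at h1
    have h2 : ∑ j ∈ Finset.univ.erase i, g j (Function.update (fun _ => z) i t j)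
        = ∑ j ∈ Finset.univ.erase i, g j z := by
      refine Finset.sum_congr rfl fun j hj => ?_
      rw [Function.update_of_ne (Finset.ne_of_mem_erase hj)]
    rw [h2] at h1
    simp only [Function.update_self] at h1
    linarith
  have hle : (∑ i, ⨆ t : Set.Ici (0 : ℝ), ((g i t : ℝ) : EReal))
      ≤ ∑ i, (((⨆ t, g i t : ℝ)) : EReal) := by
    refine Finset.sum_le_sum fun i _ => iSup_le fun t => ?_
    exact EReal.coe_le_coe_iff.2 (le_ciSup (hbdd i) t)
  refine hle.trans ?_
  have hs : ∑ i, (((⨆ t, g i t : ℝ)) : EReal) = ((∑ i, ⨆ t, g i t : ℝ) : EReal) := by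
    induction (Finset.univ : Finset (Fin N)) using Finset.induction_on with
    | empty => simp
    | insert a s ha ih => rw [Finset.sum_insert ha, Finset.sum_insert ha, ih, EReal.coe_add]
  rw [hs, EReal.coe_le_coe_iff]
  refine le_of_forall_pos_le_add fun ε hε => ?_
  have hδ : 0 < ε / (N + 1) := by positivity
  have hch : ∀ i, ∃ t, (⨆ t, g i t) - ε / (N + 1) < g i t := fun i =>
    exists_lt_of_lt_ciSup (by linarith)
  choose q hq using hch
  have h1 : ∑ i, ((⨆ t, g i t) - ε / (N + 1)) ≤ ∑ i, g i (q i) :=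
    Finset.sum_le_sum fun i _ => (hq i).le
  have h2 := h q
  rw [Finset.sum_sub_distrib] at h1
  simp only [Finset.sum_const, Finset.card_univ, Fintype.card_fin, nsmul_eq_mul] at h1
  have h3 : (N : ℝ) * (ε / (N + 1)) ≤ ε := by
    rw [← mul_div_assoc, div_le_iff₀ (by positivity)]
    nlinarith
  linarith

theorem aux_bdd {N : ℕ} (ψ : ℝ → ℝ) (hψ : ConvexOn ℝ (Set.Ici 0) ψ) (c : Fin N → ℝ) :
    BddAbove {u : ℝ | ∃ q ∈ stdSimplex ℝ (Fin N), u = ∑ i, (q i * c i - ψ (q i))} := by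
  refine ⟨∑ i, (|c i| - (2 * ψ (1/2) - max (ψ 0) (ψ 1))), ?_⟩
  rintro _ ⟨q, hq, rfl⟩
  refine Finset.sum_le_sum fun i _ => ?_
  have h0 : 0 ≤ q i := hq.1 i
  have h1 : q i ≤ 1 := by
    rw [← hq.2]
    exact Finset.single_le_sum (fun j _ => hq.1 j) (Finset.mem_univ i)
  have ha : q i * c i ≤ |c i| := by
    have := le_abs_self (c i)
    have := abs_nonneg (c i)
    nlinarith
  have hb := aux_cvx ψ hψ (q i) (1 - q i) (1/2) (1/2) h0 (by linarith)
    (by norm_num) (by norm_num) (by norm_num)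
  have hc := aux_cvx ψ hψ 0 1 (q i) (1 - q i) le_rfl zero_le_one
    h0 (by linarith) (by ring)
  rw [show (1/2 : ℝ) * q i + 1/2 * (1 - q i) = 1/2 by ring] at hb
  rw [show q i * 0 + (1 - q i) * 1 = 1 - q i by ring] at hc
  have hm0 := le_max_left (ψ 0) (ψ 1)
  have hm1 := le_max_right (ψ 0) (ψ 1)
  have : q i * ψ 0 + (1 - q i) * ψ 1 ≤ max (ψ 0) (ψ 1) := by nlinarith
  linarith

theorem aux_lam {N : ℕ} (hN : 1 ≤ N) (ψ : ℝ → ℝ) (hψ : ConvexOn ℝ (Set.Ici 0) ψ)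
    (c : Fin N → ℝ) (S : ℝ)
    (hS : ∀ q ∈ stdSimplex ℝ (Fin N), ∑ i, (q i * c i - ψ (q i)) ≤ S) :
    ∃ l : ℝ, ∀ q : Fin N → ℝ, (∀ i, 0 ≤ q i) →
      ∑ i, (q i * c i - ψ (q i)) - l * (∑ i, q i - 1) ≤ S := by
  set f : (Fin N → ℝ) → ℝ := fun q => ∑ i, (q i * c i - ψ (q i)) with hf
  have key : ∀ q r : Fin N → ℝ, (∀ i, 0 ≤ q i) → (∀ i, 0 ≤ r i) → ∑ i, q i < 1 → 1 < ∑ i, r i →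
      (f r - S) / (∑ i, r i - 1) ≤ (S - f q) / (1 - ∑ i, q i) := by
    intro q r hq hr hs hu
    set s := ∑ i, q i
    set u := ∑ i, r i
    have hus : 0 < u - s := by linarith
    set a := (u - 1) / (u - s)
    set b := (1 - s) / (u - s)
    have ha : 0 ≤ a := div_nonneg (by linarith) hus.le
    have hb : 0 ≤ b := div_nonneg (by linarith) hus.le
    have hab : a + b = 1 := by
      simp only [a, b]; field_simp; ring
    have hmem : (fun i => a * q i + b * r i) ∈ stdSimplex ℝ (Fin N) := by
      refine ⟨fun i => add_nonneg (mul_nonneg ha (hq i)) (mul_nonneg hb (hr i)), ?_⟩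
      rw [Finset.sum_add_distrib, ← Finset.mul_sum, ← Finset.mul_sum]
      change a * s + b * u = 1
      simp only [a, b]; field_simp; ring
    have h1 := hS _ hmem
    have h2 : a * f q + b * f r ≤ S := by
      refine le_trans ?_ h1
      simp only [hf]
      rw [Finset.mul_sum, Finset.mul_sum, ← Finset.sum_add_distrib]
      refine Finset.sum_le_sum fun i _ => ?_
      have := aux_cvx ψ hψ (q i) (r i) a b (hq i) (hr i) ha hb hab
      nlinarith
    rw [div_le_div_iff₀ (by linarith) (by linarith)]
    have h3 : (u - 1) * f q + (1 - s) * f r ≤ S * (u - s) := by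
      have : (u - s) * (a * f q + b * f r) = (u - 1) * f q + (1 - s) * f r := by
        simp only [a, b]; field_simp
      nlinarith
    nlinarith
  set A : Set ℝ := {x | ∃ r : Fin N → ℝ, (∀ i, 0 ≤ r i) ∧ 1 < ∑ i, r i ∧
    x = (f r - S) / (∑ i, r i - 1)} with hA
  have hAne : A.Nonempty := by
    refine ⟨_, fun _ => 2, fun _ => by norm_num, ?_, rfl⟩
    have : (1 : ℝ) ≤ N := by exact_mod_cast hN
    simp; linarith
  have hAb : ∀ q : Fin N → ℝ, (∀ i, 0 ≤ q i) → ∑ i, q i < 1 →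
      (S - f q) / (1 - ∑ i, q i) ∈ upperBounds A := by
    rintro q hq hs _ ⟨r, hr, hu, rfl⟩
    exact key q r hq hr hs hu
  have hbd : BddAbove A := ⟨_, hAb (fun _ => 0) (fun _ => le_refl _) (by simp)⟩
  refine ⟨sSup A, fun q hq => ?_⟩
  change f q - _ ≤ S
  rcases lt_trichotomy (∑ i, q i) 1 with h | h | h
  · have := csSup_le hAne (hAb q hq h)
    rw [le_div_iff₀ (by linarith)] at this
    linarith
  · rw [h]
    have : f q ≤ S := hS q ⟨hq, h⟩
    linarith
  · have := le_csSup hbd ⟨q, hq, h, rfl⟩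
    rw [div_le_iff₀ (by linarith)] at this
    linarith


/-- For convex `ψ : [0,∞) → ℝ`, `G > 0` and `c ∈ ℝ^N`,
`sup_{q ∈ Δ^N} Σ (q_i c_i − ψ(q_i)) = inf_{y ∈ ℝ} [ Σ ψ*(c_i − G y) + G y ]`,
where `ψ*(v) = sup_{t ≥ 0}(vt − ψ(t))` takes values in `ℝ ∪ {+∞}` (here `EReal`); in
particular the infimum is finite and equals the finite left-hand side. -/
theorem stmt8 {N : ℕ} (hN : 1 ≤ N) (ψ : ℝ → ℝ) (hψ : ConvexOn ℝ (Set.Ici 0) ψ)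
    (G : ℝ) (hG : 0 < G) (c : Fin N → ℝ) :
    (⨅ y : ℝ,
      ((∑ i, ⨆ t : Set.Ici (0 : ℝ), (((c i - G * y) * (t : ℝ) - ψ (t : ℝ) : ℝ) : EReal)) +
        ((G * y : ℝ) : EReal))) =
    ((sSup {u : ℝ | ∃ q ∈ stdSimplex ℝ (Fin N), u = ∑ i, (q i * c i - ψ (q i))} : ℝ) : EReal) := by
  have hbdd := aux_bdd ψ hψ c
  set U : Set ℝ := {u : ℝ | ∃ q ∈ stdSimplex ℝ (Fin N), u = ∑ i, (q i * c i - ψ (q i))} with hU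
  have hne : U.Nonempty := by
    have i0 : Fin N := ⟨0, hN⟩
    exact ⟨_, _, single_mem_stdSimplex ℝ i0, rfl⟩
  apply le_antisymm
  · obtain ⟨l, hl⟩ := aux_lam hN ψ hψ c (sSup U) (fun q hq => le_csSup hbdd ⟨q, hq, rfl⟩)
    refine (iInf_le _ (l / G)).trans ?_
    have hGl : G * (l / G) = l := by field_simp
    rw [hGl]
    have := aux_sup (fun i t => (c i - l) * (t : ℝ) - ψ (t : ℝ)) (sSup U - l) (by
      intro q
      have h1 := hl (fun i => (q i : ℝ)) (fun i => (q i).2)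
      have h2 : ∑ i, ((c i - l) * (q i : ℝ) - ψ (q i : ℝ))
          = ∑ i, ((q i : ℝ) * c i - ψ (q i)) - l * ∑ i, (q i : ℝ) := by
        rw [Finset.mul_sum, ← Finset.sum_sub_distrib]
        exact Finset.sum_congr rfl fun i _ => by ring
      rw [h2]
      linarith)
    refine (add_le_add_left this (l : EReal)).trans ?_
    rw [← EReal.coe_add, sub_add_cancel]
  · refine le_iInf fun y => ?_
    have hq : ∀ u ∈ U, (u : EReal) ≤
        ((∑ i, ⨆ t : Set.Ici (0 : ℝ), (((c i - G * y) * (t : ℝ) - ψ (t : ℝ) : ℝ) : EReal)) +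
        ((G * y : ℝ) : EReal)) := by
      rintro _ ⟨q, hq, rfl⟩
      have e : ∑ i, (q i * c i - ψ (q i))
          = (∑ i, ((c i - G * y) * q i - ψ (q i))) + G * y := by
        have h2 : ∑ i, ((c i - G * y) * q i - ψ (q i))
            = ∑ i, (q i * c i - ψ (q i)) - (G * y) * ∑ i, q i := by
          rw [Finset.mul_sum, ← Finset.sum_sub_distrib]
          exact Finset.sum_congr rfl fun i _ => by ring
        rw [h2, hq.2]; ring
      have hs : ∀ g : Fin N → ℝ, ((∑ i, g i : ℝ) : EReal) = ∑ i, ((g i : ℝ) : EReal) := by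
        intro g
        induction (Finset.univ : Finset (Fin N)) using Finset.induction_on with
        | empty => simp
        | insert a s ha ih => rw [Finset.sum_insert ha, Finset.sum_insert ha, EReal.coe_add, ih]
      rw [e, EReal.coe_add, hs]
      refine add_le_add_left (Finset.sum_le_sum fun i _ => ?_) _
      exact le_iSup (fun t : Set.Ici (0 : ℝ) =>
        (((c i - G * y) * (t : ℝ) - ψ (t : ℝ) : ℝ) : EReal)) ⟨q i, hq.1 i⟩
    generalize ((∑ i, ⨆ t : Set.Ici (0 : ℝ),
      (((c i - G * y) * (t : ℝ) - ψ (t : ℝ) : ℝ) : EReal)) + ((G * y : ℝ) : EReal)) = R at hq ⊢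
    induction R with
    | bot =>
      obtain ⟨u, hu⟩ := hne
      exact absurd (hq u hu) (by simp)
    | top => exact le_top
    | coe R =>
      rw [EReal.coe_le_coe_iff]
      exact csSup_le hne fun u hu => EReal.coe_le_coe_iff.1 (hq u hu)
end

section
/- Let ψ : [0,∞) → ℝ be convex, ε' > 0, and ψ_ε(t) = ψ(t) + ε' t log t (with 0·log 0 = 0). Then for every v ∈ ℝ the function t ↦ vt − ψ_ε(t) attains its maximum over t ≥ 0 at a unique point q(v), this maximizer satisfies q(v) > 0, and for all v₁ ≤ v₂: 0 ≤ log q(v₂) − log q(v₁) ≤ (v₂ − v₁)/ε'. Equivalently, v ↦ log q(v) (= log of the derivative of the Fenchel conjugate of ψ_ε) is nondecreasing and (1/ε')-Lipschitz on ℝ. -/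
lemma xlogx_tangent (a s : ℝ) (ha : 0 < a) (hs : 0 ≤ s) :
    a * Real.log a + (1 + Real.log a) * (s - a) ≤ s * Real.log s := by
  rcases hs.eq_or_lt with h | h
  · subst h; simp; nlinarith
  · have h1 := Real.log_le_sub_one_of_pos (div_pos ha h)
    rw [Real.log_div ha.ne' h.ne'] at h1
    have h2 := mul_le_mul_of_nonneg_left h1 h.le
    have h3 : s * (a / s - 1) = a - s := by field_simp
    rw [h3] at h2
    nlinarith

lemma left_bound (ψ : ℝ → ℝ) (hψ : ConvexOn ℝ (Set.Ici 0) ψ) (ε' : ℝ) (hε' : 0 < ε') (v : ℝ) :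
    ∃ δ : ℝ, 0 < δ ∧ δ < 1 ∧ ∀ s, 0 ≤ s → s < δ →
      v * s - (ψ s + ε' * s * Real.log s) < v * δ - (ψ δ + ε' * δ * Real.log δ) := by
  set c := |v - (ψ 2 - ψ 1)| / ε' + 2 with hc
  have hc0 : 2 ≤ c := by
    have : 0 ≤ |v - (ψ 2 - ψ 1)| / ε' := by positivity
    linarith
  refine ⟨Real.exp (-c), Real.exp_pos _, by rw [Real.exp_lt_one_iff]; linarith, ?_⟩
  intro s hs hsd
  have hd1 : Real.exp (-c) < 1 := by rw [Real.exp_lt_one_iff]; linarith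
  have hd0 := Real.exp_pos (-c)
  have hl : Real.log (Real.exp (-c)) = -c := Real.log_exp _
  set δ := Real.exp (-c)
  have ht := xlogx_tangent δ s hd0 hs
  have s1 := hψ.slope_mono_adjacent (x := s) (y := δ) (z := 1) hs (by simp) hsd hd1
  have s2 := hψ.slope_mono_adjacent (x := δ) (y := 1) (z := 2) hd0.le (by simp) hd1 (by norm_num)
  have s3 := s1.trans s2
  rw [div_le_iff₀ (by linarith)] at s3
  norm_num at s3
  rw [hl] at ht ⊢
  have hk : 0 < v - (ψ 2 - ψ 1) - ε' * (1 + -c) := by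
    have : ε' * c = |v - (ψ 2 - ψ 1)| + 2 * ε' := by rw [hc]; field_simp
    have := neg_abs_le (v - (ψ 2 - ψ 1))
    nlinarith
  have h1 := mul_pos hk (sub_pos.2 hsd)
  have h2 := mul_le_mul_of_nonneg_left ht hε'.le
  nlinarith

lemma right_bound (ψ : ℝ → ℝ) (hψ : ConvexOn ℝ (Set.Ici 0) ψ) (ε' : ℝ) (hε' : 0 < ε') (v : ℝ) :
    ∃ R : ℝ, 1 < R ∧ ∀ s, R < s →
      v * s - (ψ s + ε' * s * Real.log s) < v * R - (ψ R + ε' * R * Real.log R) := by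
  set c := |v - (ψ 1 - ψ 0)| / ε' + 2 with hc
  have hc0 : 2 ≤ c := by
    have : 0 ≤ |v - (ψ 1 - ψ 0)| / ε' := by positivity
    linarith
  have hd1 : 1 < Real.exp c := by rw [Real.one_lt_exp_iff]; linarith
  refine ⟨Real.exp c, hd1, ?_⟩
  intro s hsd
  have hl : Real.log (Real.exp c) = c := Real.log_exp _
  set R := Real.exp c
  have hs : 0 ≤ s := by linarith
  have ht := xlogx_tangent R s (by linarith) hs
  have s1 := hψ.slope_mono_adjacent (x := 0) (y := 1) (z := R) (by simp)
    (by simp only [Set.mem_Ici]; linarith) (by norm_num) hd1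
  have s2 := hψ.slope_mono_adjacent (x := 1) (y := R) (z := s) (by simp) hs hd1 hsd
  have s3 := s1.trans s2
  rw [le_div_iff₀ (by linarith)] at s3
  norm_num at s3
  rw [hl] at ht ⊢
  have hk : 0 < -(v - (ψ 1 - ψ 0)) + ε' * (1 + c) := by
    have : ε' * c = |v - (ψ 1 - ψ 0)| + 2 * ε' := by rw [hc]; field_simp
    have := le_abs_self (v - (ψ 1 - ψ 0))
    nlinarith
  have h1 := mul_pos hk (sub_pos.2 hsd)
  have h2 := mul_le_mul_of_nonneg_left ht hε'.le
  nlinarith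

lemma max_exists (ψ : ℝ → ℝ) (hψ : ConvexOn ℝ (Set.Ici 0) ψ) (ε' : ℝ) (hε' : 0 < ε') (v : ℝ) :
    ∃ t : ℝ, 0 ≤ t ∧
      IsMaxOn (fun s => v * s - (ψ s + ε' * s * Real.log s)) (Set.Ici 0) t := by
  obtain ⟨δ, hd0, hd1, hd⟩ := left_bound ψ hψ ε' hε' v
  obtain ⟨R, hR1, hR⟩ := right_bound ψ hψ ε' hε' v
  have hcψ : ContinuousOn ψ (Set.Icc δ R) := by
    have h := hψ.continuousOn_interior
    rw [interior_Ici] at h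
    exact h.mono fun x hx => lt_of_lt_of_le hd0 hx.1
  have hlog : ContinuousOn Real.log (Set.Icc δ R) :=
    Real.continuousOn_log.mono fun x hx => (lt_of_lt_of_le hd0 hx.1).ne'
  have hc : ContinuousOn (fun s => v * s - (ψ s + ε' * s * Real.log s)) (Set.Icc δ R) := by
    fun_prop
  obtain ⟨q, hq, hmax⟩ := isCompact_Icc.exists_isMaxOn ⟨δ, by constructor <;> linarith⟩ hc
  rw [isMaxOn_iff] at hmax
  refine ⟨q, hd0.le.trans hq.1, ?_⟩
  rw [isMaxOn_iff]
  intro s hs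
  rcases lt_or_ge s δ with h | h
  · exact (hd s hs h).le.trans (hmax δ ⟨le_rfl, by linarith⟩)
  · rcases lt_or_ge R s with h' | h'
    · exact (hR s h').le.trans (hmax R ⟨by linarith, le_rfl⟩)
    · exact hmax s ⟨h, h'⟩

lemma max_pos (ψ : ℝ → ℝ) (hψ : ConvexOn ℝ (Set.Ici 0) ψ) (ε' : ℝ) (hε' : 0 < ε') (v q : ℝ)
    (hq : 0 ≤ q) (hm : IsMaxOn (fun s => v * s - (ψ s + ε' * s * Real.log s)) (Set.Ici 0) q) :
    0 < q := by
  obtain ⟨δ, hd0, hd1, hd⟩ := left_bound ψ hψ ε' hε' v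
  by_contra h
  have := hd q hq (by linarith)
  have := isMaxOn_iff.1 hm δ hd0.le
  linarith

lemma max_subgrad (ψ : ℝ → ℝ) (hψ : ConvexOn ℝ (Set.Ici 0) ψ) (ε' : ℝ) (hε' : 0 < ε') (v q : ℝ)
    (hq : 0 < q) (hm : IsMaxOn (fun s => v * s - (ψ s + ε' * s * Real.log s)) (Set.Ici 0) q)
    (s : ℝ) (hs : 0 < s) :
    (v - ε' * (1 + Real.log q)) * (s - q) ≤ ψ s - ψ q := by
  have hlim : Filter.Tendsto (fun l : ℝ => (v - ε' * (1 + Real.log (q + l * (s - q)))) * (s - q))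
      (nhdsWithin 0 (Set.Ioi 0)) (nhds ((v - ε' * (1 + Real.log q)) * (s - q))) := by
    have : ContinuousAt
        (fun l : ℝ => (v - ε' * (1 + Real.log (q + l * (s - q)))) * (s - q)) 0 := by
      have : q + 0 * (s - q) ≠ 0 := by simpa using hq.ne'
      fun_prop (disch := assumption)
    have h := this.tendsto
    simp only [zero_mul, add_zero] at h
    exact h.mono_left nhdsWithin_le_nhds
  refine le_of_tendsto hlim ?_
  filter_upwards [Ioo_mem_nhdsGT (show (0:ℝ) < 1 by norm_num)] with l hl
  obtain ⟨hl0, hl1⟩ := hl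
  have ht0 : 0 < q + l * (s - q) := by nlinarith [mul_pos hl0 hs, mul_pos (sub_pos.2 hl1) hq]
  have hcv := hψ.2 (Set.mem_Ici.2 hq.le) (Set.mem_Ici.2 hs.le)
    (show (0:ℝ) ≤ 1 - l by linarith) hl0.le (by ring)
  simp only [smul_eq_mul] at hcv
  rw [show (1 - l) * q + l * s = q + l * (s - q) by ring] at hcv
  have hM := isMaxOn_iff.1 hm _ ht0.le
  have htan := mul_le_mul_of_nonneg_left (xlogx_tangent _ q ht0 hq.le) hε'.le
  refine le_of_mul_le_mul_left ?_ hl0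
  linarith


/-- For convex `ψ : [0,∞) → ℝ`, `ε' > 0`, and
`ψ_ε(t) = ψ(t) + ε' t log t` (with `0·log 0 = 0`, automatic from `Real.log 0 = 0`):
for every `v` the map `t ↦ vt − ψ_ε(t)` has a unique maximizer `q(v)` over `t ≥ 0`; it is
positive; and for `v₁ ≤ v₂`, `0 ≤ log q(v₂) − log q(v₁) ≤ (v₂ − v₁)/ε'`, i.e.
`v ↦ log q(v)` is nondecreasing and `(1/ε')`-Lipschitz. -/
theorem stmt9 (ψ : ℝ → ℝ) (hψ : ConvexOn ℝ (Set.Ici 0) ψ) (ε' : ℝ) (hε' : 0 < ε') :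
    (∀ v : ℝ, ∃! t : ℝ, 0 ≤ t ∧
      IsMaxOn (fun s => v * s - (ψ s + ε' * s * Real.log s)) (Set.Ici 0) t) ∧
    (∀ v₁ v₂ q₁ q₂ : ℝ, v₁ ≤ v₂ →
      0 ≤ q₁ → IsMaxOn (fun s => v₁ * s - (ψ s + ε' * s * Real.log s)) (Set.Ici 0) q₁ →
      0 ≤ q₂ → IsMaxOn (fun s => v₂ * s - (ψ s + ε' * s * Real.log s)) (Set.Ici 0) q₂ →
      0 < q₁ ∧ 0 < q₂ ∧ 0 ≤ Real.log q₂ - Real.log q₁ ∧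
        Real.log q₂ - Real.log q₁ ≤ (v₂ - v₁) / ε') := by

  have key : ∀ v₁ v₂ q₁ q₂ : ℝ, v₁ ≤ v₂ →
      0 ≤ q₁ → IsMaxOn (fun s => v₁ * s - (ψ s + ε' * s * Real.log s)) (Set.Ici 0) q₁ →
      0 ≤ q₂ → IsMaxOn (fun s => v₂ * s - (ψ s + ε' * s * Real.log s)) (Set.Ici 0) q₂ →
      0 < q₁ ∧ 0 < q₂ ∧ 0 ≤ Real.log q₂ - Real.log q₁ ∧
        Real.log q₂ - Real.log q₁ ≤ (v₂ - v₁) / ε' := by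
    intro v₁ v₂ q₁ q₂ hv h1 m1 h2 m2
    have p1 := max_pos ψ hψ ε' hε' v₁ q₁ h1 m1
    have p2 := max_pos ψ hψ ε' hε' v₂ q₂ h2 m2
    have g1 := max_subgrad ψ hψ ε' hε' v₁ q₁ p1 m1 q₂ p2
    have g2 := max_subgrad ψ hψ ε' hε' v₂ q₂ p2 m2 q₁ p1
    have g : 0 ≤ ((v₂ - v₁) - ε' * (Real.log q₂ - Real.log q₁)) * (q₂ - q₁) := by linarith
    have hmono : 0 ≤ Real.log q₂ - Real.log q₁ := by
      by_contra h
      push Not at h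
      have hq : q₂ < q₁ := (Real.log_lt_log_iff p2 p1).1 (by linarith)
      have := mul_neg_of_pos_of_neg hε' h
      have := mul_neg_of_pos_of_neg
        (show 0 < (v₂ - v₁) - ε' * (Real.log q₂ - Real.log q₁) by linarith) (sub_neg.2 hq)
      linarith
    refine ⟨p1, p2, hmono, ?_⟩
    rw [le_div_iff₀ hε']
    by_contra h
    push Not at h
    have hlt : 0 < Real.log q₂ - Real.log q₁ := by
      by_contra h'
      have : Real.log q₂ - Real.log q₁ = 0 := by linarith
      rw [this] at h
      linarith
    have hq : q₁ < q₂ := (Real.log_lt_log_iff p1 p2).1 (by linarith)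
    have := mul_neg_of_neg_of_pos
        (show (v₂ - v₁) - ε' * (Real.log q₂ - Real.log q₁) < 0 by linarith) (sub_pos.2 hq)
    linarith
  refine ⟨fun v => ?_, key⟩
  obtain ⟨t, ht, hm⟩ := max_exists ψ hψ ε' hε' v
  refine ⟨t, ⟨ht, hm⟩, ?_⟩
  rintro y ⟨hy, hmy⟩
  obtain ⟨a, b, c, d⟩ := key v v t y le_rfl ht hm hy hmy
  rw [sub_self, zero_div] at d
  exact Real.log_injOn_pos b a (by linarith)
end

section
/- Let ψ : [0,∞) → ℝ be convex, ε' > 0, ψ_ε(t) = ψ(t) + ε' t log t, and let q(v) be the unique maximizer over t ≥ 0 of t ↦ vt − ψ_ε(t). Then the Fenchel conjugate ψ_ε* is finite and differentiable on all of ℝ with (ψ_ε*)'(v) = q(v). Moreover, for any N ≥ 1, c ∈ ℝ^N and G > 0, the function y ↦ Σ_{i∈[N]} ψ_ε*(c_i − G y) + G y attains its minimum over ℝ, and any minimizer ȳ satisfies Σ_{i∈[N]} q(c_i − G ȳ) = 1; in particular the vector (q(c_i − G ȳ))_{i∈[N]} lies in the probability simplex Δ^N. -/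
noncomputable section

/-- Entropy-regularized divergence function `ψ_ε(t) = ψ(t) + ε' t log t`
(the convention `0·log 0 = 0` is automatic since `Real.log 0 = 0`). -/
def psiEps (ψ : ℝ → ℝ) (ε' t : ℝ) : ℝ := ψ t + ε' * t * Real.log t

/-- The Fenchel conjugate of `ψ_ε`: `ψ_ε*(v) = sup_{t ≥ 0} (vt − ψ_ε(t))`. -/
def psiEpsStar (ψ : ℝ → ℝ) (ε' v : ℝ) : ℝ :=
  sSup {u : ℝ | ∃ t, 0 ≤ t ∧ u = v * t - psiEps ψ ε' t}

/-- The dual objective `Υ(y) = Σ_i ψ_ε*(c_i − G y) + G y`. -/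
def UpsilonDual {N : ℕ} (ψ : ℝ → ℝ) (ε' G : ℝ) (c : Fin N → ℝ) (y : ℝ) : ℝ :=
  (∑ i, psiEpsStar ψ ε' (c i - G * y)) + G * y

theorem ent_one (s u : ℝ) (hs : 0 ≤ s) (hu : 0 < u) :
    2 * s * (s - u) ≤ s ^ 2 * Real.log (s ^ 2) - s ^ 2 * Real.log (u ^ 2) := by
  rcases hs.eq_or_lt with h | h
  · subst h; simp
  · have h1 := Real.log_le_sub_one_of_pos (div_pos hu h)
    rw [Real.log_div hu.ne' h.ne'] at h1
    have h2 : s * (u / s) = u := by field_simp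
    rw [Real.log_pow, Real.log_pow]
    push_cast
    have h3 := mul_le_mul_of_nonneg_left h1 (by positivity : 0 ≤ 2 * s ^ 2)
    have h4 : 2 * s ^ 2 * (u / s - 1) = 2 * s * (u - s) := by
      rw [mul_sub, show 2 * s ^ 2 * (u / s) = 2 * s * (s * (u / s)) by ring, h2]; ring
    nlinarith

theorem ent_two (s r : ℝ) (hs : 0 ≤ s) (hr : 0 ≤ r) :
    (s - r) ^ 2 / 2 ≤ s ^ 2 * Real.log (s ^ 2) + r ^ 2 * Real.log (r ^ 2)
      - 2 * (((s ^ 2 + r ^ 2) / 2) * Real.log ((s ^ 2 + r ^ 2) / 2)) := by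
  rcases (by positivity : 0 ≤ (s ^ 2 + r ^ 2) / 2).eq_or_lt with h | h
  · have h1 : s = 0 := by nlinarith [sq_nonneg s, sq_nonneg r]
    have h2 : r = 0 := by nlinarith [sq_nonneg s, sq_nonneg r]
    subst h1 h2; simp
  · obtain ⟨u, hu, hm⟩ : ∃ u : ℝ, 0 < u ∧ (s ^ 2 + r ^ 2) / 2 = u ^ 2 :=
      ⟨_, Real.sqrt_pos.2 h, (Real.sq_sqrt h.le).symm⟩
    rw [hm]
    have e1 := ent_one s u hs hu
    have e2 := ent_one r u hr hu
    have e3 : s ^ 2 * Real.log (u ^ 2) + r ^ 2 * Real.log (u ^ 2)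
        = 2 * (u ^ 2 * Real.log (u ^ 2)) := by rw [← hm]; ring
    nlinarith [sq_nonneg (s + r - 2 * u)]

theorem Q_lip (ψ : ℝ → ℝ) (hψ : ConvexOn ℝ (Set.Ici 0) ψ) (ε' : ℝ) (hε' : 0 < ε')
    (v w a b : ℝ) (ha : 0 ≤ a) (hb : 0 ≤ b)
    (hA : ∀ t, 0 ≤ t → v * t - psiEps ψ ε' t ≤ v * a - psiEps ψ ε' a)
    (hB : ∀ t, 0 ≤ t → w * t - psiEps ψ ε' t ≤ w * b - psiEps ψ ε' b)
    (hvw : |w - v| ≤ ε' / 2) : |b - a| ≤ 16 * a / ε' * |w - v| := by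
  obtain ⟨s, hs, rfl⟩ : ∃ s : ℝ, 0 ≤ s ∧ a = s ^ 2 :=
    ⟨_, Real.sqrt_nonneg a, (Real.sq_sqrt ha).symm⟩
  obtain ⟨r, hr, rfl⟩ : ∃ s : ℝ, 0 ≤ s ∧ b = s ^ 2 :=
    ⟨_, Real.sqrt_nonneg b, (Real.sq_sqrt hb).symm⟩
  have h1 := hA ((s ^ 2 + r ^ 2) / 2) (by positivity)
  have h2 := hB ((s ^ 2 + r ^ 2) / 2) (by positivity)
  have h3 := hψ.2 (Set.mem_Ici.2 ha) (Set.mem_Ici.2 hb) (by norm_num : (0 : ℝ) ≤ 1 / 2)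
    (by norm_num : (0 : ℝ) ≤ 1 / 2) (by norm_num)
  simp only [smul_eq_mul] at h3
  rw [show 1 / 2 * s ^ 2 + 1 / 2 * r ^ 2 = (s ^ 2 + r ^ 2) / 2 by ring] at h3
  have h4 := mul_le_mul_of_nonneg_left (ent_two s r hs hr) hε'.le
  simp only [psiEps] at h1 h2
  have h5 : ε' * (s - r) ^ 2 ≤ (w - v) * (r - s) * (r + s) := by nlinarith
  have h6 : ε' * |r - s| ≤ |w - v| * (r + s) := by
    rcases (abs_nonneg (r - s)).eq_or_lt with h | h
    · rw [← h, mul_zero]; positivity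
    · refine le_of_mul_le_mul_right ?_ h
      have : (w - v) * (r - s) ≤ |w - v| * |r - s| := by
        rw [← abs_mul]; exact le_abs_self _
      have h7 := mul_le_mul_of_nonneg_right this (by positivity : 0 ≤ r + s)
      have h8 : |r - s| * |r - s| = (s - r) ^ 2 := by rw [abs_mul_abs_self]; ring
      nlinarith
  have h7 : r ≤ 3 * s := by
    have h8 := mul_le_mul_of_nonneg_right hvw (by positivity : 0 ≤ r + s)
    have h9 := mul_le_mul_of_nonneg_left (le_abs_self (r - s)) hε'.le
    have : ε' * r ≤ ε' * (3 * s) := by nlinarith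
    exact le_of_mul_le_mul_left this hε'
  have h8 : |r ^ 2 - s ^ 2| = |r - s| * (r + s) := by
    rw [show r ^ 2 - s ^ 2 = (r - s) * (r + s) by ring, abs_mul, abs_of_nonneg (by positivity : 0 ≤ r + s)]
  rw [h8, div_mul_eq_mul_div, le_div_iff₀ hε']
  calc |r - s| * (r + s) * ε' = (ε' * |r - s|) * (r + s) := by ring
    _ ≤ (|w - v| * (r + s)) * (r + s) := by gcongr
    _ = |w - v| * ((r + s) * (r + s)) := by ring
    _ ≤ |w - v| * ((4 * s) * (4 * s)) := by
      gcongr <;> linarith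
    _ = _ := by ring

/-- For convex `ψ`, `ε' > 0` and `q(v)` the (unique) maximizer over `t ≥ 0`
of `t ↦ vt − ψ_ε(t)`: the conjugate `ψ_ε*` is finite (the defining set is bounded above) and
differentiable with `(ψ_ε*)'(v) = q(v)`; moreover for any `c ∈ ℝ^N` and `G > 0` the dual
objective `y ↦ Σ ψ_ε*(c_i − G y) + G y` attains its minimum, and any minimizer `ȳ` satisfies
`Σ_i q(c_i − G ȳ) = 1`, so `(q(c_i − G ȳ))_i ∈ Δ^N`. -/
theorem stmt10 (ψ : ℝ → ℝ) (hψ : ConvexOn ℝ (Set.Ici 0) ψ) (ε' : ℝ) (hε' : 0 < ε')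
    (Q : ℝ → ℝ)
    (hQ : ∀ v, 0 ≤ Q v ∧ IsMaxOn (fun t => v * t - psiEps ψ ε' t) (Set.Ici 0) (Q v))
    {N : ℕ} (hN : 1 ≤ N) (c : Fin N → ℝ) (G : ℝ) (hG : 0 < G) :
    (∀ v : ℝ, BddAbove {u : ℝ | ∃ t, 0 ≤ t ∧ u = v * t - psiEps ψ ε' t}) ∧
    (∀ v : ℝ, HasDerivAt (psiEpsStar ψ ε') (Q v) v) ∧
    (∃ ybar : ℝ, IsMinOn (UpsilonDual ψ ε' G c) Set.univ ybar) ∧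
    (∀ ybar : ℝ, IsMinOn (UpsilonDual ψ ε' G c) Set.univ ybar →
      (∑ i, Q (c i - G * ybar)) = 1 ∧
      (fun i => Q (c i - G * ybar)) ∈ stdSimplex ℝ (Fin N)) := by
  have hM : ∀ v t, 0 ≤ t → v * t - psiEps ψ ε' t ≤ v * Q v - psiEps ψ ε' (Q v) :=
    fun v t ht => (hQ v).2 ht
  have hbdd : ∀ v : ℝ, BddAbove {u : ℝ | ∃ t, 0 ≤ t ∧ u = v * t - psiEps ψ ε' t} := by
    intro v
    refine ⟨v * Q v - psiEps ψ ε' (Q v), ?_⟩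
    rintro u ⟨t, ht, rfl⟩
    exact hM v t ht
  have hge : ∀ v t, 0 ≤ t → v * t - psiEps ψ ε' t ≤ psiEpsStar ψ ε' v :=
    fun v t ht => le_csSup (hbdd v) ⟨t, ht, rfl⟩
  have hF : ∀ v, psiEpsStar ψ ε' v = v * Q v - psiEps ψ ε' (Q v) := by
    intro v
    refine le_antisymm (csSup_le ⟨_, Q v, (hQ v).1, rfl⟩ ?_) (hge v _ (hQ v).1)
    rintro u ⟨t, ht, rfl⟩
    exact hM v t ht
  have hder : ∀ v : ℝ, HasDerivAt (psiEpsStar ψ ε') (Q v) v := by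
    intro v
    have hO : (fun w => psiEpsStar ψ ε' w - psiEpsStar ψ ε' v - (w - v) • Q v)
        =O[nhds v] fun w => (w - v) ^ 2 := by
      refine Asymptotics.IsBigO.of_bound (16 * Q v / ε') ?_
      filter_upwards [Metric.closedBall_mem_nhds v (half_pos hε')] with w hw
      rw [Metric.mem_closedBall, Real.dist_eq] at hw
      have hl := Q_lip ψ hψ ε' hε' v w (Q v) (Q w) (hQ v).1 (hQ w).1 (hM v) (hM w) hw
      have k1 := hM w (Q v) (hQ v).1
      have k2 := hM v (Q w) (hQ w).1
      rw [hF, hF, smul_eq_mul, Real.norm_eq_abs, Real.norm_eq_abs, abs_pow, pow_two, ← mul_assoc]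
      rw [abs_of_nonneg (by linarith)]
      calc _ ≤ (Q w - Q v) * (w - v) := by linarith
        _ ≤ |Q w - Q v| * |w - v| := by rw [← abs_mul]; exact le_abs_self _
        _ ≤ _ := by gcongr
    rw [hasDerivAt_iff_isLittleO]
    refine hO.trans_isLittleO ?_
    simpa using Asymptotics.isLittleO_pow_sub_sub v one_lt_two
  have hU : ∀ y, HasDerivAt (UpsilonDual ψ ε' G c)
      ((∑ i, Q (c i - G * y) * (-G)) + G) y := by
    intro y
    have hlin : HasDerivAt (fun y : ℝ => G * y) G y := by
      simpa using (hasDerivAt_id y).const_mul G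
    exact (HasDerivAt.fun_sum fun i _ =>
      (hder (c i - G * y)).comp y (hlin.const_sub (c i))).add hlin
  refine ⟨hbdd, hder, ?_, ?_⟩
  · have hcont : Continuous (UpsilonDual ψ ε' G c) :=
      continuous_iff_continuousAt.2 fun y => (hU y).continuousAt
    have hN' : (1 : ℝ) ≤ N := by exact_mod_cast hN
    have htop : Filter.Tendsto (UpsilonDual ψ ε' G c) Filter.atTop Filter.atTop := by
      refine Filter.tendsto_atTop_mono (f := fun y => (∑ i : Fin N, (-psiEps ψ ε' 0)) + G * y) ?_ ?_
      · intro y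
        refine add_le_add_left (Finset.sum_le_sum fun i _ => ?_) _
        have := hge (c i - G * y) 0 le_rfl
        linarith
      · exact Filter.tendsto_atTop_add_const_left _ _ (Filter.tendsto_id.const_mul_atTop hG)
    have hbot : Filter.Tendsto (UpsilonDual ψ ε' G c) Filter.atBot Filter.atTop := by
      refine Filter.tendsto_atTop_mono
        (f := fun y => (∑ i : Fin N, (c i * 2 - psiEps ψ ε' 2)) + (-(2 * N - 1) * G) * y) ?_ ?_
      · intro y
        have := Finset.sum_le_sum (s := Finset.univ) fun (i : Fin N) _ =>
          hge (c i - G * y) 2 (by norm_num)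
        have e : ∑ i : Fin N, ((c i - G * y) * 2 - psiEps ψ ε' 2)
            = (∑ i : Fin N, (c i * 2 - psiEps ψ ε' 2)) - N * (2 * G * y) := by
          rw [eq_sub_iff_add_eq]
          have : (N : ℝ) * (2 * G * y) = ∑ i : Fin N, (2 * G * y) := by simp
          rw [this, ← Finset.sum_add_distrib]
          exact Finset.sum_congr rfl fun i _ => by ring
        rw [e] at this
        simp only [UpsilonDual]
        linarith
      · refine Filter.tendsto_atTop_add_const_left _ _
          (Filter.tendsto_id.const_mul_atBot_of_neg ?_)
        nlinarith
    obtain ⟨y, hy⟩ := hcont.exists_forall_le (by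
      rw [cocompact_eq_atBot_atTop]; exact hbot.sup htop)
    exact ⟨y, fun z _ => hy z⟩
  · intro y hy
    have h0 := (hy.isLocalMin Filter.univ_mem).hasDerivAt_eq_zero (hU y)
    rw [← Finset.sum_mul] at h0
    have h1 : (∑ i, Q (c i - G * y)) = 1 := by
      have : G * (∑ i, Q (c i - G * y)) = G * 1 := by linarith
      exact mul_left_cancel₀ hG.ne' this
    exact ⟨h1, fun i => (hQ _).1, h1⟩
end
end

section
/- Let ψ : [0,∞) → ℝ be convex, ε' > 0, ψ_ε(t) = ψ(t) + ε' t log t, G > 0, and let ℓ_1,…,ℓ_N : 𝒳 → ℝ. Define Υ_ε(x,y) = Σ_{i∈[N]} ψ_ε*(ℓ_i(x) − G y) + G y. Suppose that for x, x' ∈ 𝒳 the functions Υ_ε(x,·) and Υ_ε(x',·) each have a unique minimizer y*(x), y*(x') over ℝ. Then |y*(x) − y*(x')| ≤ (1/G) max_{i∈[N]} |ℓ_i(x) − ℓ_i(x')|. Moreover, if each ℓ_i is G-Lipschitz, then |y*(x) − y*(x')| ≤ ‖x − x'‖. -/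
noncomputable section

theorem aux_ent (K ε t : ℝ) (hε : 0 < ε) (ht : 0 ≤ t) :
    K * t - ε * t * Real.log t ≤ ε * Real.exp (K / ε - 1) := by
  rcases ht.eq_or_lt with rfl | ht
  · simp; positivity
  · have h := Real.add_one_le_exp (K / ε - 1 - Real.log t)
    rw [Real.exp_sub _ (Real.log t), Real.exp_log ht, le_div_iff₀ ht] at h
    have h2 := mul_le_mul_of_nonneg_left h hε.le
    have h3 : ε * ((K / ε - 1 - Real.log t + 1) * t) = K * t - ε * t * Real.log t := by
      field_simp
      ring
    linarith

theorem aux_bdd_s11 (ψ : ℝ → ℝ) (hψ : ConvexOn ℝ (Set.Ici 0) ψ) (ε v : ℝ) (hε : 0 < ε) :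
    BddAbove {u : ℝ | ∃ t, 0 ≤ t ∧ u = v * t - psiEps ψ ε t} := by
  set s1 := ψ 1 - ψ 0
  set s2 := ψ 2 - ψ 1
  refine ⟨max (ε * Real.exp ((v - s1) / ε - 1) + s1 - ψ 1)
    (ε * Real.exp ((v - s2) / ε - 1) + s2 - ψ 1), ?_⟩
  rintro u ⟨t, ht, rfl⟩
  unfold psiEps
  rcases le_total 1 t with h | h
  · refine le_max_of_le_left ?_
    have h1 := aux_ent (v - s1) ε t hε ht
    have htp : 0 < t := by linarith
    have h2 := hψ.2 (show (0:ℝ) ∈ Set.Ici 0 by simp) (show t ∈ Set.Ici 0 from ht)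
      (show 0 ≤ 1 - 1 / t by rw [sub_nonneg, div_le_one htp]; exact h) (show 0 ≤ 1 / t by positivity) (by ring)
    have e : (1 - 1 / t) • (0:ℝ) + (1 / t) • t = 1 := by simp; field_simp
    rw [e] at h2
    simp only [smul_eq_mul] at h2
    have h3 := mul_le_mul_of_nonneg_left h2 ht
    have e2 : t * ((1 - 1 / t) * ψ 0 + 1 / t * ψ t) = (t - 1) * ψ 0 + ψ t := by
      field_simp
    simp only [s1] at *
    nlinarith
  · refine le_max_of_le_right ?_
    have h1 := aux_ent (v - s2) ε t hε ht
    have htp : 0 < 2 - t := by linarith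
    have h2 := hψ.2 (show t ∈ Set.Ici 0 from ht) (show (2:ℝ) ∈ Set.Ici 0 by simp)
      (show 0 ≤ 1 / (2 - t) by positivity) (show 0 ≤ 1 - 1 / (2 - t) by rw [sub_nonneg, div_le_one htp]; linarith) (by ring)
    have e : (1 / (2 - t)) • t + (1 - 1 / (2 - t)) • (2:ℝ) = 1 := by
      simp only [smul_eq_mul]; field_simp; ring
    rw [e] at h2
    simp only [smul_eq_mul] at h2
    have h3 := mul_le_mul_of_nonneg_left h2 htp.le
    have e2 : (2 - t) * (1 / (2 - t) * ψ t + (1 - 1 / (2 - t)) * ψ 2)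
        = ψ t + (1 - t) * ψ 2 := by
      field_simp
      ring
    simp only [s2] at *
    nlinarith

theorem aux_conv (ψ : ℝ → ℝ) (hψ : ConvexOn ℝ (Set.Ici 0) ψ) (ε : ℝ) (hε : 0 < ε) :
    ConvexOn ℝ Set.univ (psiEpsStar ψ ε) := by
  refine ⟨convex_univ, ?_⟩
  intro p _ q _ a b ha hb hab
  refine csSup_le ⟨_, 0, le_rfl, rfl⟩ ?_
  rintro u ⟨t, ht, rfl⟩
  have h1 : p * t - psiEps ψ ε t ≤ psiEpsStar ψ ε p :=
    le_csSup (aux_bdd_s11 ψ hψ ε p hε) ⟨t, ht, rfl⟩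
  have h2 : q * t - psiEps ψ ε t ≤ psiEpsStar ψ ε q :=
    le_csSup (aux_bdd_s11 ψ hψ ε q hε) ⟨t, ht, rfl⟩
  have h3 := mul_le_mul_of_nonneg_left h1 ha
  have h4 := mul_le_mul_of_nonneg_left h2 hb
  simp only [smul_eq_mul]
  obtain rfl : b = 1 - a := by linarith
  nlinarith

theorem aux_incr (f : ℝ → ℝ) (hf : ConvexOn ℝ Set.univ f) (p q h : ℝ) (hpq : p ≤ q)
    (hh : 0 < h) : f (p + h) + f q ≤ f p + f (q + h) := by
  have hD : 0 < q + h - p := by linarith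
  have ha : 0 ≤ (q - p) / (q + h - p) := div_nonneg (by linarith) hD.le
  have hb : 0 ≤ h / (q + h - p) := by positivity
  have hab : (q - p) / (q + h - p) + h / (q + h - p) = 1 := by field_simp; ring
  have h1 := hf.2 (Set.mem_univ p) (Set.mem_univ (q + h)) ha hb hab
  have h2 := hf.2 (Set.mem_univ p) (Set.mem_univ (q + h)) hb ha (by linarith)
  have e1 : ((q - p) / (q + h - p)) • p + (h / (q + h - p)) • (q + h) = p + h := by
    simp only [smul_eq_mul]; field_simp; ring
  have e2 : (h / (q + h - p)) • p + ((q - p) / (q + h - p)) • (q + h) = q := by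
    simp only [smul_eq_mul]; field_simp; ring
  rw [e1] at h1
  rw [e2] at h2
  simp only [smul_eq_mul] at h1 h2
  generalize (q - p) / (q + h - p) = a at *
  obtain rfl : a = 1 - h / (q + h - p) := by linarith
  linarith

theorem aux_main {N : ℕ} (ψ : ℝ → ℝ) (hψ : ConvexOn ℝ (Set.Ici 0) ψ)
    (ε G : ℝ) (hε : 0 < ε) (hG : 0 < G) (c c' : Fin N → ℝ) (a b S : ℝ)
    (ha : IsMinOn (UpsilonDual ψ ε G c) Set.univ a)
    (hau : ∀ y, IsMinOn (UpsilonDual ψ ε G c) Set.univ y → y = a)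
    (hb : IsMinOn (UpsilonDual ψ ε G c') Set.univ b)
    (hS : ∀ i, |c i - c' i| ≤ S) : G * (a - b) ≤ S := by
  by_contra! hlt
  set h := G * (a - b) - S with hh
  have hpos : 0 < h := by linarith
  have hGd : G * (h / G) = h := by field_simp
  have hd : 0 < h / G := by positivity
  have h1 : UpsilonDual ψ ε G c a < UpsilonDual ψ ε G c (a - h / G) := by
    by_contra! hle
    have := hau (a - h / G) (fun y hy => hle.trans (ha hy))
    linarith
  have h2 : UpsilonDual ψ ε G c' b ≤ UpsilonDual ψ ε G c' (b + h / G) := hb (Set.mem_univ _)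
  have h3 : ∑ i, (psiEpsStar ψ ε (c i - G * (a - h / G)) + psiEpsStar ψ ε (c' i - G * (b + h / G)))
      ≤ ∑ i, (psiEpsStar ψ ε (c i - G * a) + psiEpsStar ψ ε (c' i - G * b)) := by
    refine Finset.sum_le_sum fun i _ => ?_
    have hi := abs_le.1 (hS i)
    have := aux_incr _ (aux_conv ψ hψ ε hε) (c i - G * a) (c' i - G * (b + h / G)) h
      (by rw [mul_add, hGd]; linarith) hpos
    have e1 : c i - G * (a - h / G) = c i - G * a + h := by rw [mul_sub, hGd]; ring
    have e2 : c' i - G * b = c' i - G * (b + h / G) + h := by rw [mul_add, hGd]; ring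
    rw [e1, e2]
    exact this
  rw [Finset.sum_add_distrib, Finset.sum_add_distrib] at h3
  unfold UpsilonDual at h1 h2
  linarith

/-- If `Υ_ε(x,·)` and `Υ_ε(x',·)` have unique minimizers `y*(x)`, `y*(x')`
over `ℝ`, then `|y*(x) − y*(x')| ≤ (1/G) max_i |ℓ_i(x) − ℓ_i(x')|`; moreover, if each `ℓ_i`
is `G`-Lipschitz, then `|y*(x) − y*(x')| ≤ ‖x − x'‖`. -/
theorem stmt11 {d N : ℕ} (hN : 1 ≤ N)
    (𝒳 : Set (EuclideanSpace ℝ (Fin d))) (hXconv : Convex ℝ 𝒳) (hXcl : IsClosed 𝒳)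
    (ψ : ℝ → ℝ) (hψ : ConvexOn ℝ (Set.Ici 0) ψ)
    (ε' G : ℝ) (hε' : 0 < ε') (hG : 0 < G)
    (ℓ : Fin N → EuclideanSpace ℝ (Fin d) → ℝ)
    (x x' : EuclideanSpace ℝ (Fin d)) (hx : x ∈ 𝒳) (hx' : x' ∈ 𝒳)
    (yx yx' : ℝ)
    (hyx : IsMinOn (UpsilonDual ψ ε' G (fun i => ℓ i x)) Set.univ yx)
    (hyxu : ∀ y, IsMinOn (UpsilonDual ψ ε' G (fun i => ℓ i x)) Set.univ y → y = yx)
    (hyx' : IsMinOn (UpsilonDual ψ ε' G (fun i => ℓ i x')) Set.univ yx')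
    (hyx'u : ∀ y, IsMinOn (UpsilonDual ψ ε' G (fun i => ℓ i x')) Set.univ y → y = yx')
    (S : ℝ) (hS : IsGreatest {v : ℝ | ∃ i, v = |ℓ i x - ℓ i x'|} S) :
    |yx - yx'| ≤ (1 / G) * S ∧
    ((∀ i, ∀ z ∈ 𝒳, ∀ z' ∈ 𝒳, |ℓ i z - ℓ i z'| ≤ G * ‖z - z'‖) →
      |yx - yx'| ≤ ‖x - x'‖) := by
  have hSb : ∀ i, |ℓ i x - ℓ i x'| ≤ S := fun i => hS.2 ⟨i, rfl⟩
  have key : G * |yx - yx'| ≤ S := by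
    have h1 := aux_main ψ hψ ε' G hε' hG _ _ yx yx' S hyx hyxu hyx' hSb
    have h2 := aux_main ψ hψ ε' G hε' hG _ _ yx' yx S hyx' hyx'u hyx
      (fun i => by rw [abs_sub_comm]; exact hSb i)
    rcases abs_cases (yx - yx') with ⟨h, _⟩ | ⟨h, _⟩ <;> rw [h] <;> linarith
  constructor
  · rw [one_div_mul_eq_div, le_div_iff₀ hG]
    linarith
  · intro hL
    obtain ⟨i, hi⟩ := hS.1
    have := hL i x hx x' hx'
    exact le_of_mul_le_mul_left (by linarith) hG
end
end

section
/- Let ψ : [0,∞) → ℝ be convex, ε' > 0, ψ_ε(t) = ψ(t) + ε' t log t, G > 0, and let each ℓ_i : 𝒳 → ℝ be convex, differentiable and G-Lipschitz. Let x̄ ∈ 𝒳, let ȳ minimize y ↦ Υ_ε(x̄, y) over ℝ, set p̄_i = q(ℓ_i(x̄) − G ȳ) (so that Σ_i p̄_i = 1), and r_ε = ε'/G. For all x ∈ B_{r_ε}(x̄) ∩ 𝒳 and y ∈ [ȳ − r_ε, ȳ + r_ε], define ĝˣ_i(x,y) = (q(ℓ_i(x) − G y)/p̄_i) ∇ℓ_i(x)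 and ĝʸ_i(x,y) = G (1 − q(ℓ_i(x) − G y)/p̄_i). Then: (i) Σ_{i∈[N]} p̄_i ĝˣ_i(x,y) = ∇_x Υ_ε(x,y) and Σ_{i∈[N]} p̄_i ĝʸ_i(x,y) = ∂_y Υ_ε(x,y); (ii) Σ_{i∈[N]} p̄_i ‖ĝˣ_i(x,y)‖² ≤ e⁴ G² and Σ_{i∈[N]} p̄_i (ĝʸ_i(x,y))² ≤ e⁴ G². -/
noncomputable section

lemma aux_pos (ψ : ℝ → ℝ) (hψ : ConvexOn ℝ (Set.Ici 0) ψ) (ε' : ℝ) (hε' : 0 < ε') (v a : ℝ)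
    (ha : 0 ≤ a) (hm : IsMaxOn (fun t => v * t - psiEps ψ ε' t) (Set.Ici 0) a) : 0 < a := by
  rcases ha.lt_or_eq with h | h
  · exact h
  exfalso
  subst h
  set K := v - ψ 1 + ψ 0 with hK
  set M := |K| / ε' + 1 with hM
  have hMpos : 0 < M := by positivity
  have ht1 : Real.exp (-M) ≤ 1 := by
    rw [Real.exp_le_one_iff]; linarith
  have ht0 := Real.exp_pos (-M)
  have h1 := hm (show Real.exp (-M) ∈ Set.Ici (0:ℝ) from ht0.le)
  simp only [Set.mem_ofPred_eq, psiEps, Real.log_exp] at h1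
  have h2 := hψ.2 (show (0:ℝ) ∈ Set.Ici (0:ℝ) by simp) (show (1:ℝ) ∈ Set.Ici (0:ℝ) by simp)
    (show 0 ≤ 1 - Real.exp (-M) by linarith) ht0.le (by ring)
  simp only [smul_eq_mul, mul_zero, mul_one, zero_add] at h2
  have hKM : ε' * M = |K| + ε' := by rw [hM]; field_simp
  have h3 : Real.exp (-M) * (K + ε' * M) ≤ 0 := by
    rw [hK]; nlinarith
  have h4 : 0 < K + ε' * M := by
    rw [hKM]; linarith [neg_abs_le K]
  nlinarith [mul_pos ht0 h4]

lemma aux_sub (ψ : ℝ → ℝ) (hψ : ConvexOn ℝ (Set.Ici 0) ψ) (ε' : ℝ) (hε' : 0 < ε') (v a b : ℝ)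
    (ha : 0 < a) (hb : 0 < b)
    (hm : IsMaxOn (fun t => v * t - psiEps ψ ε' t) (Set.Ici 0) a) :
    (v - ε' * (Real.log a + 1)) * (b - a) ≤ ψ b - ψ a := by
  have key : ∀ s ∈ Set.Ioo (0:ℝ) 1,
      (v - ε' * (Real.log (a + s * (b - a)) + 1)) * (b - a) ≤ ψ b - ψ a := by
    rintro s ⟨hs0, hs1⟩
    have hc : 0 < a + s * (b - a) := by nlinarith [mul_pos hs0 hb, mul_pos (sub_pos.2 hs1) ha]
    have h2 := hψ.2 (show a ∈ Set.Ici (0:ℝ) from ha.le) (show b ∈ Set.Ici (0:ℝ) from hb.le)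
      (show 0 ≤ 1 - s by linarith) hs0.le (by ring)
    simp only [smul_eq_mul] at h2
    rw [show (1 - s) * a + s * b = a + s * (b - a) by ring] at h2
    have h1 := hm (show a + s * (b - a) ∈ Set.Ici (0:ℝ) from hc.le)
    simp only [Set.mem_ofPred_eq, psiEps] at h1
    have hl := Real.log_le_sub_one_of_pos (div_pos hc ha)
    rw [Real.log_div hc.ne' ha.ne'] at hl
    have hl2 : a * (Real.log (a + s * (b - a)) - Real.log a) ≤ s * (b - a) := by
      have := mul_le_mul_of_nonneg_left hl ha.le
      have e : a * ((a + s * (b - a)) / a - 1) = s * (b - a) := by field_simp; ring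
      linarith
    set L := Real.log (a + s * (b - a))
    set l := Real.log a
    have h3 := mul_le_mul_of_nonneg_left hl2 hε'.le
    have h4 : s * ((v - ε' * (L + 1)) * (b - a)) ≤ s * (ψ b - ψ a) := by nlinarith
    exact le_of_mul_le_mul_left h4 hs0
  have hcont : ContinuousAt
      (fun s : ℝ => (v - ε' * (Real.log (a + s * (b - a)) + 1)) * (b - a)) 0 := by
    have : a + 0 * (b - a) ≠ 0 := by simpa using ha.ne'
    fun_prop (disch := assumption)
  have ht := hcont.tendsto.mono_left (nhdsWithin_le_nhds (s := Set.Ioi (0:ℝ)))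
  simp only [zero_mul, add_zero] at ht
  refine le_of_tendsto ht ?_
  filter_upwards [Ioo_mem_nhdsGT (show (0:ℝ) < 1 by norm_num)] with s hs using key s hs

lemma aux_log (ψ : ℝ → ℝ) (hψ : ConvexOn ℝ (Set.Ici 0) ψ) (ε' : ℝ) (hε' : 0 < ε')
    (Q : ℝ → ℝ)
    (hQ : ∀ v, 0 ≤ Q v ∧ IsMaxOn (fun t => v * t - psiEps ψ ε' t) (Set.Ici 0) (Q v))
    (v w : ℝ) : Real.log (Q v) - Real.log (Q w) ≤ |v - w| / ε' := by
  have hp := fun v => aux_pos ψ hψ ε' hε' v (Q v) (hQ v).1 (hQ v).2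
  rcases le_or_gt (Q v) (Q w) with h | h
  · have := Real.log_le_log (hp v) h
    have : 0 ≤ |v - w| / ε' := by positivity
    linarith
  · have h1 := aux_sub ψ hψ ε' hε' v (Q v) (Q w) (hp v) (hp w) (hQ v).2
    have h2 := aux_sub ψ hψ ε' hε' w (Q w) (Q v) (hp w) (hp v) (hQ w).2
    rw [le_div_iff₀ hε']
    have h3 : (ε' * (Real.log (Q v) - Real.log (Q w))) * (Q v - Q w) ≤ (v - w) * (Q v - Q w) := by
      nlinarith
    have := le_of_mul_le_mul_right h3 (sub_pos.2 h)
    linarith [le_abs_self (v - w)]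

lemma aux_ratio (ψ : ℝ → ℝ) (hψ : ConvexOn ℝ (Set.Ici 0) ψ) (ε' : ℝ) (hε' : 0 < ε')
    (Q : ℝ → ℝ)
    (hQ : ∀ v, 0 ≤ Q v ∧ IsMaxOn (fun t => v * t - psiEps ψ ε' t) (Set.Ici 0) (Q v))
    (v w : ℝ) : Q v / Q w ≤ Real.exp (|v - w| / ε') := by
  have hp := fun v => aux_pos ψ hψ ε' hε' v (Q v) (hQ v).1 (hQ v).2
  rw [← Real.log_le_iff_le_exp (div_pos (hp v) (hp w)), Real.log_div (hp v).ne' (hp w).ne']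
  exact aux_log ψ hψ ε' hε' Q hQ v w

lemma aux_cont (ψ : ℝ → ℝ) (hψ : ConvexOn ℝ (Set.Ici 0) ψ) (ε' : ℝ) (hε' : 0 < ε')
    (Q : ℝ → ℝ)
    (hQ : ∀ v, 0 ≤ Q v ∧ IsMaxOn (fun t => v * t - psiEps ψ ε' t) (Set.Ici 0) (Q v))
    (v : ℝ) : ContinuousAt Q v := by
  have hp := fun v => aux_pos ψ hψ ε' hε' v (Q v) (hQ v).1 (hQ v).2
  have hlow : ContinuousAt (fun w => Q v / Real.exp (|v - w| / ε')) v := by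
    have : ∀ w, Real.exp (|v - w| / ε') ≠ 0 := fun w => (Real.exp_pos _).ne'
    fun_prop (disch := exact this _)
  have hup : ContinuousAt (fun w => Q v * Real.exp (|w - v| / ε')) v := by fun_prop
  have h1 := hlow.tendsto
  have h2 := hup.tendsto
  simp only [sub_self, abs_zero, zero_div, Real.exp_zero, div_one, mul_one] at h1 h2
  refine tendsto_of_tendsto_of_tendsto_of_le_of_le h1 h2 (fun w => ?_) (fun w => ?_)
  · have := aux_ratio ψ hψ ε' hε' Q hQ v w
    rw [div_le_iff₀ (hp w)] at this
    show Q v / Real.exp (|v - w| / ε') ≤ Q w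
    rw [div_le_iff₀ (Real.exp_pos _)]
    linarith
  · have := aux_ratio ψ hψ ε' hε' Q hQ w v
    rw [div_le_iff₀ (hp v)] at this
    show Q w ≤ Q v * Real.exp (|w - v| / ε')
    linarith

lemma aux_deriv (ψ : ℝ → ℝ) (hψ : ConvexOn ℝ (Set.Ici 0) ψ) (ε' : ℝ) (hε' : 0 < ε')
    (Q : ℝ → ℝ)
    (hQ : ∀ v, 0 ≤ Q v ∧ IsMaxOn (fun t => v * t - psiEps ψ ε' t) (Set.Ici 0) (Q v))
    (v : ℝ) : HasDerivAt (psiEpsStar ψ ε') (Q v) v := by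
  have hst : ∀ w, psiEpsStar ψ ε' w = w * Q w - psiEps ψ ε' (Q w) := by
    intro w
    refine IsGreatest.csSup_eq ⟨⟨Q w, (hQ w).1, rfl⟩, ?_⟩
    rintro u ⟨t, ht, rfl⟩
    exact (hQ w).2 (show t ∈ Set.Ici (0:ℝ) from ht)
  have hlo : ∀ v w, (w - v) * Q v ≤ psiEpsStar ψ ε' w - psiEpsStar ψ ε' v := by
    intro v w
    have := (hQ w).2 (show Q v ∈ Set.Ici (0:ℝ) from (hQ v).1)
    simp only [Set.mem_ofPred_eq] at this
    rw [hst, hst]; linarith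
  rw [hasDerivAt_iff_isLittleO, Asymptotics.isLittleO_iff]
  intro c hc
  have hcont := aux_cont ψ hψ ε' hε' Q hQ v
  filter_upwards [Metric.continuousAt_iff'.1 hcont c hc] with w hw
  rw [Real.dist_eq] at hw
  have h1 := hlo v w
  have h2 := hlo w v
  rw [smul_eq_mul, Real.norm_eq_abs, Real.norm_eq_abs, abs_of_nonneg (by linarith)]
  calc _ ≤ (w - v) * (Q w - Q v) := by linarith
    _ ≤ |(w - v) * (Q w - Q v)| := le_abs_self _
    _ = |Q w - Q v| * |w - v| := by rw [abs_mul, mul_comm]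
    _ ≤ _ := by gcongr

/-- With `p̄_i = q(ℓ_i(x̄) − G ȳ)` (summing to 1), `r_ε = ε'/G`, for all
`x ∈ B_{r_ε}(x̄) ∩ 𝒳` and `y ∈ [ȳ − r_ε, ȳ + r_ε]`, the importance-weighted gradient
estimators `ĝˣ_i = (q(ℓ_i(x) − G y)/p̄_i) ∇ℓ_i(x)` and `ĝʸ_i = G(1 − q(ℓ_i(x) − G y)/p̄_i)`
with `i ~ p̄` are unbiased for `∇_x Υ_ε(x,y)` and `∂_y Υ_ε(x,y)`, and their second moments
are bounded by `e⁴ G²`. -/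
theorem stmt13 {d N : ℕ} (hN : 1 ≤ N)
    (𝒳 : Set (EuclideanSpace ℝ (Fin d))) (hXconv : Convex ℝ 𝒳) (hXcl : IsClosed 𝒳)
    (ψ : ℝ → ℝ) (hψ : ConvexOn ℝ (Set.Ici 0) ψ) (ε' : ℝ) (hε' : 0 < ε')
    (G : ℝ) (hG : 0 < G)
    (Q : ℝ → ℝ)
    (hQ : ∀ v, 0 ≤ Q v ∧ IsMaxOn (fun t => v * t - psiEps ψ ε' t) (Set.Ici 0) (Q v))
    (ℓ : Fin N → EuclideanSpace ℝ (Fin d) → ℝ)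
    (gradℓ : Fin N → EuclideanSpace ℝ (Fin d) → EuclideanSpace ℝ (Fin d))
    (hconv : ∀ i, ConvexOn ℝ 𝒳 (ℓ i))
    (hdiff : ∀ i z, HasGradientAt (ℓ i) (gradℓ i z) z)
    (hlip : ∀ i (z z' : EuclideanSpace ℝ (Fin d)), |ℓ i z - ℓ i z'| ≤ G * ‖z - z'‖)
    (xbar : EuclideanSpace ℝ (Fin d)) (hxbar : xbar ∈ 𝒳)
    (ybar : ℝ) (hybar : IsMinOn (UpsilonDual ψ ε' G (fun i => ℓ i xbar)) Set.univ ybar)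
    (rε : ℝ) (hrε : rε = ε' / G)
    (x : EuclideanSpace ℝ (Fin d)) (hx : x ∈ Metric.closedBall xbar rε ∩ 𝒳)
    (y : ℝ) (hy : y ∈ Set.Icc (ybar - rε) (ybar + rε)) :
    (∑ i, Q (ℓ i xbar - G * ybar)) = 1 ∧
    HasGradientAt (fun z => UpsilonDual ψ ε' G (fun i => ℓ i z) y)
      (∑ i, Q (ℓ i xbar - G * ybar) •
        ((Q (ℓ i x - G * y) / Q (ℓ i xbar - G * ybar)) • gradℓ i x)) x ∧
    HasDerivAt (UpsilonDual ψ ε' G (fun i => ℓ i x))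
      (∑ i, Q (ℓ i xbar - G * ybar) *
        (G * (1 - Q (ℓ i x - G * y) / Q (ℓ i xbar - G * ybar)))) y ∧
    (∑ i, Q (ℓ i xbar - G * ybar) *
        ‖(Q (ℓ i x - G * y) / Q (ℓ i xbar - G * ybar)) • gradℓ i x‖ ^ 2)
      ≤ Real.exp 4 * G ^ 2 ∧
    (∑ i, Q (ℓ i xbar - G * ybar) *
        (G * (1 - Q (ℓ i x - G * y) / Q (ℓ i xbar - G * ybar))) ^ 2)
      ≤ Real.exp 4 * G ^ 2 := by
  have hp := fun v => aux_pos ψ hψ ε' hε' v (Q v) (hQ v).1 (hQ v).2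
  have hD := aux_deriv ψ hψ ε' hε' Q hQ
  have hDy : ∀ (c : Fin N → ℝ) (y : ℝ), HasDerivAt (UpsilonDual ψ ε' G c)
      (G - G * ∑ i, Q (c i - G * y)) y := by
    intro c y
    have hG1 : HasDerivAt (fun y : ℝ => G * y) G y := by
      simpa using (hasDerivAt_id y).const_mul G
    have h1 : ∀ i ∈ Finset.univ, HasDerivAt (fun y => psiEpsStar ψ ε' (c i - G * y))
        (Q (c i - G * y) * (-G)) y := fun i _ =>
      HasDerivAt.comp (h₂ := psiEpsStar ψ ε') y (hD (c i - G * y)) (hG1.const_sub (c i))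
    have h2 := (HasDerivAt.fun_sum h1).add hG1
    refine HasDerivAt.congr_deriv h2 ?_
    rw [← Finset.sum_mul]; ring
  have hsum : (∑ i, Q (ℓ i xbar - G * ybar)) = 1 := by
    have hmin : IsLocalMin (UpsilonDual ψ ε' G (fun i => ℓ i xbar)) ybar :=
      hybar.isLocalMin Filter.univ_mem
    have := hmin.hasDerivAt_eq_zero (hDy _ ybar)
    have h : G * (1 - ∑ i, Q (ℓ i xbar - G * ybar)) = 0 := by linarith
    rcases mul_eq_zero.1 h with h | h
    · exact absurd h hG.ne'
    · linarith
  have hr : ∀ i, Q (ℓ i x - G * y) / Q (ℓ i xbar - G * ybar) ≤ Real.exp 2 := by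
    intro i
    refine (aux_ratio ψ hψ ε' hε' Q hQ _ _).trans (Real.exp_le_exp.2 ?_)
    rw [div_le_iff₀ hε']
    have h1 := hlip i x xbar
    have h2 : ‖x - xbar‖ ≤ rε := by simpa [dist_eq_norm] using hx.1
    have h3 : G * rε = ε' := by rw [hrε]; field_simp
    have h4 := mul_le_mul_of_nonneg_left h2 hG.le
    have h5 := mul_le_mul_of_nonneg_left hy.1 hG.le
    have h6 := mul_le_mul_of_nonneg_left hy.2 hG.le
    have h7 := abs_le.1 h1
    rw [abs_le]
    constructor <;> nlinarith [h7.1, h7.2]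
  have hr0 : ∀ i, 0 < Q (ℓ i x - G * y) / Q (ℓ i xbar - G * ybar) := fun i =>
    div_pos (hp _) (hp _)
  have he : Real.exp 4 = Real.exp 2 ^ 2 := by
    rw [← Real.exp_nat_mul]; norm_num
  have hgn : ∀ i, ‖gradℓ i x‖ ≤ G := by
    intro i
    have h := HasFDerivAt.le_of_lip' (hdiff i x).hasFDerivAt hG.le
      (Filter.Eventually.of_forall fun z => by rw [Real.norm_eq_abs]; exact hlip i z x)
    simpa using h
  have hbd : ∀ f : Fin N → ℝ, (∀ i, f i ≤ Real.exp 4 * G ^ 2) →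
      ∑ i, Q (ℓ i xbar - G * ybar) * f i ≤ Real.exp 4 * G ^ 2 := by
    intro f hf
    calc _ ≤ ∑ i, Q (ℓ i xbar - G * ybar) * (Real.exp 4 * G ^ 2) :=
          Finset.sum_le_sum fun i _ => mul_le_mul_of_nonneg_left (hf i) (hp _).le
      _ = _ := by rw [← Finset.sum_mul, hsum, one_mul]
  refine ⟨hsum, ?_, ?_, ?_, ?_⟩
  · have h1 : ∀ i ∈ Finset.univ, HasFDerivAt (fun z => psiEpsStar ψ ε' (ℓ i z - G * y))
        (Q (ℓ i x - G * y) • (InnerProductSpace.toDual ℝ _ (gradℓ i x))) x := fun i _ =>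
      HasDerivAt.comp_hasFDerivAt (h₂ := psiEpsStar ψ ε') x (hD (ℓ i x - G * y)) ((hdiff i x).hasFDerivAt.sub_const (G * y))
    have h2 := (HasFDerivAt.fun_sum h1).add_const (G * y)
    rw [hasGradientAt_iff_hasFDerivAt]
    refine HasFDerivAt.congr_fderiv h2 ?_
    rw [map_sum]
    refine Finset.sum_congr rfl fun i _ => ?_
    rw [smul_smul, mul_div_cancel₀ _ (hp _).ne']
    simp
  · refine HasDerivAt.congr_deriv (hDy _ y) ?_
    have : ∀ i, Q (ℓ i xbar - G * ybar) *
        (G * (1 - Q (ℓ i x - G * y) / Q (ℓ i xbar - G * ybar))) =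
        G * Q (ℓ i xbar - G * ybar) - G * Q (ℓ i x - G * y) := by
      intro i
      have := (hp (ℓ i xbar - G * ybar)).ne'
      field_simp
    simp only [this, Finset.sum_sub_distrib, ← Finset.mul_sum, hsum, mul_one]
  · refine hbd _ fun i => ?_
    rw [norm_smul, Real.norm_eq_abs, abs_of_pos (hr0 i), mul_pow, he]
    have := hr i
    have := hgn i
    have := (hr0 i).le
    gcongr
  · refine hbd _ fun i => ?_
    rw [mul_pow, he, mul_comm]
    have h1 := hr i
    have h2 := hr0 i
    have h3 : (1:ℝ) ≤ Real.exp 2 := Real.one_le_exp (by norm_num)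
    refine mul_le_mul_of_nonneg_right ?_ (by positivity)
    apply sq_le_sq'  <;> linarith
end
end

section
/- Let U ⊆ Δ^N be a nonempty closed convex set, let ε' > 0, and let each ℓ_i : ℝ^d → ℝ be convex, differentiable, G-Lipschitz, and L-smooth (with L-Lipschitz gradient). Define 𝓛̃_DRO(x) = max_{q∈U} ( Σ_{i∈[N]} q_i ℓ_i(x) − ε' Σ_{i∈[N]} q_i log q_i ). Then for each x the maximum is attained at a unique q*(x) ∈ U, 𝓛̃_DRO is differentiable with ∇𝓛̃_DRO(x) = Σ_{i∈[N]} q*_i(x) ∇ℓ_i(x), and ∇𝓛̃_DRO is (L + G²/ε')-Lipschitz: ‖∇𝓛̃_DRO(x) − ∇𝓛̃_DRO(y)‖ ≤ (L + G²/ε')‖x − y‖ for all x, y ∈ ℝ^d. -/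
lemma aux_log_s16 {u : ℝ} (hu : 0 < u) :
    (u - 1) * (5 * u + 1) / (2 * u + 4) ≤ u * Real.log u := by
  let f : ℝ → ℝ := fun u => Real.log u - (5 * u ^ 2 - 4 * u - 1) / (2 * u ^ 2 + 4 * u)
  have hd : ∀ v : ℝ, 0 < v → HasDerivAt f ((v - 1) ^ 3 / (v ^ 2 * (v + 2) ^ 2)) v := by
    intro v hv
    have h1 := Real.hasDerivAt_log hv.ne'
    have hn : HasDerivAt (fun u : ℝ => 5 * u ^ 2 - 4 * u - 1) (10 * v - 4) v := by
      have := (((hasDerivAt_pow 2 v).const_mul 5).sub ((hasDerivAt_id v).const_mul 4)).sub_const 1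
      refine this.congr_deriv ?_
      simp; ring
    have hdn : HasDerivAt (fun u : ℝ => 2 * u ^ 2 + 4 * u) (4 * v + 4) v := by
      have := (((hasDerivAt_pow 2 v).const_mul 2).add ((hasDerivAt_id v).const_mul 4))
      refine this.congr_deriv ?_
      simp; ring
    have h0 : 2 * v ^ 2 + 4 * v ≠ 0 := by positivity
    have := h1.sub (hn.div hdn h0)
    refine HasDerivAt.congr_deriv (f := f) this ?_
    have h3 : v + 2 ≠ 0 := by positivity
    have h4 : 2 * v ^ 2 + 4 * v = 2 * v * (v + 2) := by ring
    rw [h4]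
    field_simp
    ring
  have hf1 : f 1 = 0 := by simp [f]; norm_num
  have hf : 0 ≤ f u := by
    rw [← hf1]
    rcases le_total 1 u with h | h
    · have hm : MonotoneOn f (Set.Ici 1) := by
        apply monotoneOn_of_deriv_nonneg (convex_Ici 1)
        · intro v hv
          have hv : (1:ℝ) ≤ v := hv
          exact (hd v (by linarith)).continuousAt.continuousWithinAt
        · intro v hv
          rw [interior_Ici] at hv
          have hv : (1:ℝ) < v := hv
          exact (hd v (by linarith)).differentiableAt.differentiableWithinAt
        · intro v hv
          rw [interior_Ici] at hv
          have hv : (1:ℝ) < v := hv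
          rw [(hd v (by linarith)).deriv]
          have : 0 ≤ v - 1 := by linarith
          positivity
      exact hm (by simp) h h
    · have hm : AntitoneOn f (Set.Ioc 0 1) := by
        apply antitoneOn_of_deriv_nonpos (convex_Ioc 0 1)
        · intro v hv
          exact (hd v hv.1).continuousAt.continuousWithinAt
        · intro v hv
          rw [interior_Ioc] at hv
          exact (hd v hv.1).differentiableAt.differentiableWithinAt
        · intro v hv
          rw [interior_Ioc] at hv
          rw [(hd v hv.1).deriv]
          apply div_nonpos_of_nonpos_of_nonneg
          · have : 0 ≤ 1 - v := by linarith [hv.2]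
            have : 0 ≤ (1 - v) ^ 3 := by positivity
            nlinarith
          · positivity
      exact hm ⟨hu, h⟩ (by simp) h
  have : u * f u = u * Real.log u - (u - 1) * (5 * u + 1) / (2 * u + 4) := by
    simp only [f]
    have h4 : 2 * u ^ 2 + 4 * u = 2 * u * (u + 2) := by ring
    have h5 : 2 * u + 4 = 2 * (u + 2) := by ring
    have h3 : u + 2 ≠ 0 := by positivity
    rw [h4, h5]
    field_simp
    ring
  nlinarith [mul_nonneg hu.le hf]

lemma aux_pt {q m : ℝ} (hq : 0 ≤ q) (hm : 0 ≤ m) (h : m = 0 → q = 0) :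
    3 * ((q - m) ^ 2 / (2 * q + 4 * m)) ≤ q * Real.log q - q * Real.log m - q + m := by
  rcases hm.eq_or_lt with h0 | hm
  · have := h h0.symm; subst this; subst h0; simp
  rcases hq.eq_or_lt with h0 | hq
  · subst h0
    simp only [zero_mul, mul_zero]
    have : (0 - m) ^ 2 / (0 + 4 * m) = m / 4 := by field_simp; ring
    rw [this]; linarith
  have := aux_log_s16 (div_pos hq hm)
  rw [Real.log_div hq.ne' hm.ne'] at this
  have h2 := mul_le_mul_of_nonneg_left this hm.le
  have e1 : m * (q / m * (Real.log q - Real.log m)) = q * Real.log q - q * Real.log m := by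
    field_simp
  have e2 : m * ((q / m - 1) * (5 * (q / m) + 1) / (2 * (q / m) + 4))
      = 3 * ((q - m) ^ 2 / (2 * q + 4 * m)) + q - m := by
    have h1 : 2 * (q / m) + 4 = (2 * q + 4 * m) / m := by field_simp
    have : 2 * q + 4 * m ≠ 0 := by positivity
    rw [h1]
    field_simp
    ring
  linarith

lemma aux_pinsker {N : ℕ} {q m : Fin N → ℝ} (hq : q ∈ stdSimplex ℝ (Fin N))
    (hm : m ∈ stdSimplex ℝ (Fin N)) (h : ∀ i, m i = 0 → q i = 0) :
    (∑ i, |q i - m i|) ^ 2 / 2 ≤ ∑ i, q i * Real.log (q i) - ∑ i, q i * Real.log (m i) := by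
  have h1 : 3 * ∑ i, ((q i - m i) ^ 2 / (2 * q i + 4 * m i))
      ≤ ∑ i, q i * Real.log (q i) - ∑ i, q i * Real.log (m i) := by
    have := Finset.sum_le_sum (s := Finset.univ) fun i _ => aux_pt (hq.1 i) (hm.1 i) (h i)
    rw [← Finset.mul_sum] at this
    simp only [Finset.sum_add_distrib, Finset.sum_sub_distrib, hq.2, hm.2] at this
    linarith
  have h2 : (∑ i, |q i - m i|) ^ 2 ≤
      (∑ i, ((q i - m i) ^ 2 / (2 * q i + 4 * m i))) * ∑ i, (2 * q i + 4 * m i) := by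
    apply Finset.sum_sq_le_sum_mul_sum_of_sq_le_mul
    · intro i _
      have := hq.1 i; have := hm.1 i
      positivity
    · intro i _
      have := hq.1 i; have := hm.1 i
      positivity
    · intro i _
      rw [sq_abs]
      by_cases h0 : 2 * q i + 4 * m i = 0
      · have := hq.1 i; have := hm.1 i
        have a : q i = 0 := by linarith
        have b : m i = 0 := by linarith
        simp [a, b]
      · rw [div_mul_cancel₀ _ h0]
  have h3 : ∑ i, (2 * q i + 4 * m i) = 6 := by
    rw [Finset.sum_add_distrib, ← Finset.mul_sum, ← Finset.mul_sum, hq.2, hm.2]; norm_num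
  rw [h3] at h2
  linarith

lemma aux_strong {N : ℕ} {p q : Fin N → ℝ} (hp : p ∈ stdSimplex ℝ (Fin N))
    (hq : q ∈ stdSimplex ℝ (Fin N)) {t : ℝ} (h0 : 0 < t) (h1 : t < 1) :
    ∑ i, (t * q i + (1 - t) * p i) * Real.log (t * q i + (1 - t) * p i)
      + t * (1 - t) / 2 * (∑ i, |q i - p i|) ^ 2
      ≤ t * ∑ i, q i * Real.log (q i) + (1 - t) * ∑ i, p i * Real.log (p i) := by
  have h1' : 0 < 1 - t := by linarith
  let m : Fin N → ℝ := fun i => t * q i + (1 - t) * p i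
  have hm : m ∈ stdSimplex ℝ (Fin N) := by
    have := convex_stdSimplex ℝ (Fin N) hq hp h0.le h1'.le (by ring)
    exact this
  have hz : ∀ i, m i = 0 → q i = 0 ∧ p i = 0 := by
    intro i hi
    have a := mul_nonneg h0.le (hq.1 i)
    have b := mul_nonneg h1'.le (hp.1 i)
    have hi : t * q i + (1 - t) * p i = 0 := hi
    have a' : t * q i = 0 := by linarith
    have b' : (1 - t) * p i = 0 := by linarith
    exact ⟨(mul_eq_zero.1 a').resolve_left h0.ne', (mul_eq_zero.1 b').resolve_left h1'.ne'⟩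
  have k1 := aux_pinsker hq hm fun i hi => (hz i hi).1
  have k2 := aux_pinsker hp hm fun i hi => (hz i hi).2
  have e1 : ∑ i, |q i - m i| = (1 - t) * ∑ i, |q i - p i| := by
    rw [Finset.mul_sum]
    refine Finset.sum_congr rfl fun i _ => ?_
    have e : q i - m i = (1 - t) * (q i - p i) := by
      simp only [m]; ring
    rw [e, abs_mul, abs_of_pos h1']
  have e2 : ∑ i, |p i - m i| = t * ∑ i, |q i - p i| := by
    rw [Finset.mul_sum]
    refine Finset.sum_congr rfl fun i _ => ?_
    have e : m i - p i = t * (q i - p i) := by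
      simp only [m]; ring
    rw [abs_sub_comm, e, abs_mul, abs_of_pos h0]
  rw [e1] at k1
  rw [e2] at k2
  have e3 : ∑ i, m i * Real.log (m i) =
      t * ∑ i, q i * Real.log (m i) + (1 - t) * ∑ i, p i * Real.log (m i) := by
    rw [Finset.mul_sum, Finset.mul_sum, ← Finset.sum_add_distrib]
    refine Finset.sum_congr rfl fun i _ => ?_
    simp only [m]; ring
  change ∑ i, m i * Real.log (m i) + _ ≤ _
  rw [e3]
  have k1' := mul_le_mul_of_nonneg_left k1 h0.le
  have k2' := mul_le_mul_of_nonneg_left k2 h1'.le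
  nlinarith

lemma aux_max {N : ℕ} {U : Set (Fin N → ℝ)} (hUs : U ⊆ stdSimplex ℝ (Fin N))
    (hUconv : Convex ℝ U) {ε : ℝ} (hε : 0 < ε) (a : Fin N → ℝ) (F : (Fin N → ℝ) → ℝ)
    (hF : ∀ q, F q = (∑ i, q i * a i) - ε * ∑ i, q i * Real.log (q i))
    {p q : Fin N → ℝ} (hp : p ∈ U) (hq : q ∈ U) (hmax : IsMaxOn F U p) :
    F q + ε / 2 * (∑ i, |q i - p i|) ^ 2 ≤ F p := by
  set S := (∑ i, |q i - p i|) ^ 2 with hS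
  have key : ∀ t : ℝ, 0 < t → t < 1 → F q + ε / 2 * (1 - t) * S ≤ F p := by
    intro t h0 h1
    have hm : t • q + (1 - t) • p ∈ U := hUconv hq hp h0.le (by linarith) (by ring)
    have h := hmax hm
    have h : F (t • q + (1 - t) • p) ≤ F p := h
    have hs := aux_strong (hUs hp) (hUs hq) h0 h1
    have e : ∑ i, (t * q i + (1 - t) * p i) * a i =
        t * ∑ i, q i * a i + (1 - t) * ∑ i, p i * a i := by
      rw [Finset.mul_sum, Finset.mul_sum, ← Finset.sum_add_distrib]
      refine Finset.sum_congr rfl fun i _ => ?_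
      ring
    have h2 : t * (F q + ε / 2 * (1 - t) * S) ≤ t * F p := by
      have hs' := mul_le_mul_of_nonneg_left hs hε.le
      rw [hF (t • q + (1 - t) • p)] at h
      simp only [Pi.add_apply, Pi.smul_apply, smul_eq_mul] at h
      rw [e] at h
      have a1 := hF p
      have a2 := hF q
      rw [a2]
      have : t * F p = F p - (1 - t) * F p := by ring
      rw [this]
      nth_rewrite 2 [a1]
      rw [← hS] at hs'
      linarith
    exact le_of_mul_le_mul_left h2 h0
  have lim : Filter.Tendsto (fun t : ℝ => F q + ε / 2 * (1 - t) * S) (nhdsWithin 0 (Set.Ioi 0))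
      (nhds (F q + ε / 2 * S)) := by
    have : ContinuousAt (fun t : ℝ => F q + ε / 2 * (1 - t) * S) 0 := by fun_prop
    have := this.tendsto
    simp only [sub_zero, mul_one] at this
    exact this.mono_left nhdsWithin_le_nhds
  refine le_of_tendsto lim ?_
  filter_upwards [Ioo_mem_nhdsGT (show (0:ℝ) < 1 by norm_num)] with t ht
  exact key t ht.1 ht.2

/-- For a nonempty closed convex `U ⊆ Δ^N`, `ε' > 0` and convex,
differentiable, `G`-Lipschitz, `L`-smooth losses, the entropy-smoothed objective
`𝓛̃(x) = max_{q∈U} (Σ q_i ℓ_i(x) − ε' Σ q_i log q_i)` attains its maximum at a unique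
`q*(x) ∈ U`, is differentiable with `∇𝓛̃(x) = Σ q*_i(x) ∇ℓ_i(x)`, and its gradient is
`(L + G²/ε')`-Lipschitz. -/
theorem stmt16 {d N : ℕ} (hN : 1 ≤ N)
    (U : Set (Fin N → ℝ)) (hUs : U ⊆ stdSimplex ℝ (Fin N)) (hUne : U.Nonempty)
    (hUcl : IsClosed U) (hUconv : Convex ℝ U)
    (ε' G L : ℝ) (hε' : 0 < ε') (hG : 0 < G) (hL : 0 ≤ L)
    (ℓ : Fin N → EuclideanSpace ℝ (Fin d) → ℝ)
    (gradℓ : Fin N → EuclideanSpace ℝ (Fin d) → EuclideanSpace ℝ (Fin d))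
    (hconv : ∀ i, ConvexOn ℝ Set.univ (ℓ i))
    (hdiff : ∀ i z, HasGradientAt (ℓ i) (gradℓ i z) z)
    (hlip : ∀ i (z z' : EuclideanSpace ℝ (Fin d)), |ℓ i z - ℓ i z'| ≤ G * ‖z - z'‖)
    (hsmooth : ∀ i (z z' : EuclideanSpace ℝ (Fin d)),
      ‖gradℓ i z - gradℓ i z'‖ ≤ L * ‖z - z'‖)
    (obj : EuclideanSpace ℝ (Fin d) → (Fin N → ℝ) → ℝ)
    (hobj : ∀ x q, obj x q = (∑ i, q i * ℓ i x) - ε' * ∑ i, q i * Real.log (q i))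
    (Ltil : EuclideanSpace ℝ (Fin d) → ℝ)
    (hLtil : ∀ x, Ltil x = sSup {v : ℝ | ∃ q ∈ U, v = obj x q}) :
    (∀ x, ∃ qs, qs ∈ U ∧ IsMaxOn (obj x) U qs ∧
        (∀ q ∈ U, IsMaxOn (obj x) U q → q = qs) ∧
        HasGradientAt Ltil (∑ i, qs i • gradℓ i x) x) ∧
    (∀ (x z : EuclideanSpace ℝ (Fin d)) (gx gz : EuclideanSpace ℝ (Fin d)),
      HasGradientAt Ltil gx x → HasGradientAt Ltil gz z →
      ‖gx - gz‖ ≤ (L + G ^ 2 / ε') * ‖x - z‖) := by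
  have hobj' : ∀ x, ∀ q, obj x q = (∑ i, q i * (fun i => ℓ i x) i)
      - ε' * ∑ i, q i * Real.log (q i) := hobj
  have hcomp : IsCompact U := (isCompact_stdSimplex ℝ (Fin N)).of_isClosed_subset hUcl hUs
  have hex : ∀ x, ∃ q ∈ U, IsMaxOn (obj x) U q := by
    intro x
    apply hcomp.exists_isMaxOn hUne
    have : obj x = fun q => (∑ i, q i * ℓ i x) - ε' * ∑ i, q i * Real.log (q i) :=
      funext (hobj x)
    rw [this]
    have hc : ∀ i, Continuous fun q : Fin N → ℝ => q i * Real.log (q i) := fun i =>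
      Real.continuous_mul_log.comp (continuous_apply i)
    apply Continuous.continuousOn
    fun_prop
  choose Q hQU hQmax using hex
  have hval : ∀ x, Ltil x = obj x (Q x) := by
    intro x
    rw [hLtil]
    apply IsGreatest.csSup_eq
    refine ⟨⟨Q x, hQU x, rfl⟩, ?_⟩
    rintro v ⟨q, hq, rfl⟩
    exact hQmax x hq
  have hgap : ∀ x, ∀ q ∈ U, obj x q + ε' / 2 * (∑ i, |q i - Q x i|) ^ 2 ≤ obj x (Q x) :=
    fun x q hq => aux_max hUs hUconv hε' _ _ (hobj' x) (hQU x) hq (hQmax x)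
  have huniq : ∀ x, ∀ q ∈ U, IsMaxOn (obj x) U q → q = Q x := by
    intro x q hq hm
    have h1 := hgap x q hq
    have h2 : obj x (Q x) ≤ obj x q := hm (hQU x)
    have h3 : (∑ i, |q i - Q x i|) ^ 2 ≤ 0 := by
      by_contra hcon
      push Not at hcon
      have := mul_pos (half_pos hε') hcon
      linarith
    have h4 : ∑ i, |q i - Q x i| = 0 := by
      have := le_antisymm h3 (sq_nonneg _)
      exact pow_eq_zero_iff (by norm_num) |>.1 this
    rw [Finset.sum_eq_zero_iff_of_nonneg (fun i _ => abs_nonneg _)] at h4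
    funext i
    have := abs_eq_zero.1 (h4 i (Finset.mem_univ i))
    linarith
  -- difference of linear forms
  have hdl : ∀ x y (p q : Fin N → ℝ),
      |∑ i, (p i - q i) * (ℓ i x - ℓ i y)| ≤ (∑ i, |p i - q i|) * (G * ‖x - y‖) := by
    intro x y p q
    refine (Finset.abs_sum_le_sum_abs _ _).trans ?_
    rw [Finset.sum_mul]
    refine Finset.sum_le_sum fun i _ => ?_
    rw [abs_mul]
    exact mul_le_mul_of_nonneg_left (hlip i x y) (abs_nonneg _)
  have hod : ∀ x y (p q : Fin N → ℝ),
      obj x p - obj x q - (obj y p - obj y q) = ∑ i, (p i - q i) * (ℓ i x - ℓ i y) := by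
    intro x y p q
    simp only [hobj]
    have : ∑ i, (p i - q i) * (ℓ i x - ℓ i y) = ∑ i, p i * ℓ i x - ∑ i, q i * ℓ i x
        - (∑ i, p i * ℓ i y - ∑ i, q i * ℓ i y) := by
      simp only [← Finset.sum_sub_distrib]
      exact Finset.sum_congr rfl fun i _ => by ring
    rw [this]; ring
  have hQlip : ∀ x y, ∑ i, |Q x i - Q y i| ≤ G / ε' * ‖x - y‖ := by
    intro x y
    have h1 := hgap x (Q y) (hQU y)
    have h2 := hgap y (Q x) (hQU x)
    have h3 := hod x y (Q x) (Q y)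
    have h4 := (le_abs_self _).trans (hdl x y (Q x) (Q y))
    have h5 : ∑ i, |Q y i - Q x i| = ∑ i, |Q x i - Q y i| :=
      Finset.sum_congr rfl fun i _ => abs_sub_comm _ _
    rw [h5] at h1
    set S := ∑ i, |Q x i - Q y i| with hS
    have hS0 : 0 ≤ S := Finset.sum_nonneg fun i _ => abs_nonneg _
    rcases hS0.eq_or_lt with h | h
    · rw [← h]; positivity
    have h6 : S * (ε' * S) ≤ S * (G * ‖x - y‖) := by nlinarith
    have h7 := le_of_mul_le_mul_left h6 h
    rw [div_mul_eq_mul_div, le_div_iff₀ hε']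
    linarith
  have hgradG : ∀ i z, ‖gradℓ i z‖ ≤ G := by
    intro i z
    have h := (hdiff i z).hasFDerivAt.le_of_lip' hG.le
      (Filter.Eventually.of_forall fun w => by
        rw [Real.norm_eq_abs]; exact hlip i w z)
    simpa using h
  have hQsum : ∀ x, ∑ i, Q x i = 1 := fun x => (hUs (hQU x)).2
  have hQnn : ∀ x i, 0 ≤ Q x i := fun x => (hUs (hQU x)).1
  have hgrad : ∀ x, HasGradientAt Ltil (∑ i, Q x i • gradℓ i x) x := by
    intro x
    rw [hasGradientAt_iff_hasFDerivAt]
    have hb : HasFDerivAt (fun y => obj y (Q x))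
        (InnerProductSpace.toDual ℝ _ (∑ i, Q x i • gradℓ i x)) x := by
      have e : (fun y => obj y (Q x)) = fun y => (∑ i, Q x i * ℓ i y)
        - ε' * ∑ i, Q x i * Real.log (Q x i) := funext fun y => hobj y _
      rw [e]
      apply HasFDerivAt.sub_const
      rw [map_sum]
      apply HasFDerivAt.fun_sum
      intro i _
      have := (hdiff i x).hasFDerivAt.const_mul (Q x i)
      refine this.congr_fderiv ?_
      simp
    have hr : HasFDerivAt (fun y => Ltil y - obj y (Q x))
        (0 : EuclideanSpace ℝ (Fin d) →L[ℝ] ℝ) x := by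
      have hO : (fun y => Ltil y - obj y (Q x)) =O[nhds x] fun y => ‖y - x‖ ^ 2 := by
        apply Asymptotics.IsBigO.of_bound (G / ε' * G)
        refine Filter.Eventually.of_forall fun y => ?_
        have h1 : obj y (Q x) ≤ obj y (Q y) := hQmax y (hQU x)
        have h2 : obj x (Q y) ≤ obj x (Q x) := hQmax x (hQU y)
        have h3 := hod y x (Q y) (Q x)
        have h4 := (le_abs_self _).trans (hdl y x (Q y) (Q x))
        have h5 := mul_le_mul_of_nonneg_right (hQlip y x)
          (show 0 ≤ G * ‖y - x‖ by positivity)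
        rw [hval, Real.norm_eq_abs, abs_of_nonneg (by linarith), Real.norm_eq_abs,
          abs_of_nonneg (by positivity)]
        calc _ ≤ G / ε' * ‖y - x‖ * (G * ‖y - x‖) := by linarith
          _ = _ := by ring
      exact hO.hasFDerivAt one_lt_two
    have := hb.add hr
    rw [add_zero] at this
    refine this.congr_of_eventuallyEq (Filter.Eventually.of_forall fun y => ?_)
    simp
  refine ⟨fun x => ⟨Q x, hQU x, hQmax x, huniq x, hgrad x⟩, ?_⟩
  intro x z gx gz hx hz
  rw [hx.unique (hgrad x), hz.unique (hgrad z)]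
  have e : ∑ i, Q x i • gradℓ i x - ∑ i, Q z i • gradℓ i z =
      ∑ i, Q x i • (gradℓ i x - gradℓ i z) + ∑ i, (Q x i - Q z i) • gradℓ i z := by
    rw [← Finset.sum_sub_distrib, ← Finset.sum_add_distrib]
    refine Finset.sum_congr rfl fun i _ => ?_
    rw [smul_sub, sub_smul]; abel
  rw [e]
  have b1 : ‖∑ i, Q x i • (gradℓ i x - gradℓ i z)‖ ≤ L * ‖x - z‖ := by
    calc _ ≤ ∑ i, Q x i * (L * ‖x - z‖) := by
          refine norm_sum_le_of_le _ fun i _ => ?_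
          rw [norm_smul, Real.norm_eq_abs, abs_of_nonneg (hQnn x i)]
          exact mul_le_mul_of_nonneg_left (hsmooth i x z) (hQnn x i)
      _ = _ := by rw [← Finset.sum_mul, hQsum, one_mul]
  have b2 : ‖∑ i, (Q x i - Q z i) • gradℓ i z‖ ≤ G ^ 2 / ε' * ‖x - z‖ := by
    calc _ ≤ ∑ i, |Q x i - Q z i| * G := by
          refine norm_sum_le_of_le _ fun i _ => ?_
          rw [norm_smul, Real.norm_eq_abs]
          exact mul_le_mul_of_nonneg_left (hgradG i z) (abs_nonneg _)
      _ ≤ G / ε' * ‖x - z‖ * G := by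
          rw [← Finset.sum_mul]
          exact mul_le_mul_of_nonneg_right (hQlip x z) hG.le
      _ = _ := by ring
  calc _ ≤ _ := norm_add_le _ _
    _ ≤ L * ‖x - z‖ + G ^ 2 / ε' * ‖x - z‖ := add_le_add b1 b2
    _ = _ := by ring
end

section
/- Let A ∈ ℝ^{d×d} be a symmetric matrix, b ∈ ℝ^d and c ∈ ℝ. Then sup{ vᵀAv + 2u⟨b, v⟩ + c u² : (v,u) ∈ ℝ^d × ℝ, ‖v‖² + u² = 1 } ≤ max{ c + ‖b‖, ‖A‖_op + ‖b‖ }, where ‖·‖ is the Euclidean norm and ‖A‖_op is the operator norm of A. In particular, for a twice-differentiable function h(x,y) of (x,y) ∈ ℝ^d × ℝ, ‖∇²h‖_op ≤ max{ ∂²_y h + ‖∇_{xy} h‖, ‖∇²_x h‖_op + ‖∇_{xy} h‖ } pointwise. -/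
open scoped RealInnerProductSpace

/-- For a symmetric (self-adjoint) operator `A` on `ℝ^d`, `b ∈ ℝ^d` and
`c ∈ ℝ`, the quadratic form `(v,u) ↦ vᵀAv + 2u⟨b,v⟩ + c u²` on the unit sphere
`‖v‖² + u² = 1` is bounded by `max (c + ‖b‖) (‖A‖_op + ‖b‖)`. -/
theorem stmt17 {d : ℕ}
    (A : EuclideanSpace ℝ (Fin d) →L[ℝ] EuclideanSpace ℝ (Fin d))
    (hA : ∀ v w : EuclideanSpace ℝ (Fin d), ⟪A v, w⟫ = ⟪v, A w⟫)
    (b : EuclideanSpace ℝ (Fin d)) (c : ℝ) :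
    ∀ (v : EuclideanSpace ℝ (Fin d)) (u : ℝ), ‖v‖ ^ 2 + u ^ 2 = 1 →
      ⟪A v, v⟫ + 2 * u * ⟪b, v⟫ + c * u ^ 2 ≤ max (c + ‖b‖) (‖A‖ + ‖b‖) := by
  intro v u h
  have h1 : ⟪A v, v⟫ ≤ ‖A‖ * ‖v‖ ^ 2 := by
    calc ⟪A v, v⟫ ≤ ‖A v‖ * ‖v‖ := real_inner_le_norm _ _
      _ ≤ (‖A‖ * ‖v‖) * ‖v‖ := by gcongr; exact A.le_opNorm v
      _ = ‖A‖ * ‖v‖ ^ 2 := by ring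
  have h2 : 2 * u * ⟪b, v⟫ ≤ ‖b‖ := by
    have h3 : u * ⟪b, v⟫ ≤ |u| * (‖b‖ * ‖v‖) := by
      calc u * ⟪b, v⟫ ≤ |u * ⟪b, v⟫| := le_abs_self _
        _ = |u| * |⟪b, v⟫| := abs_mul _ _
        _ ≤ |u| * (‖b‖ * ‖v‖) := by gcongr; exact abs_real_inner_le_norm _ _
    have h4 : 2 * (|u| * ‖v‖) ≤ 1 := by
      nlinarith [sq_nonneg (|u| - ‖v‖), sq_abs u]
    nlinarith [mul_le_mul_of_nonneg_left h4 (norm_nonneg b)]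
  have h5 := mul_le_mul_of_nonneg_right (le_max_left (c + ‖b‖) (‖A‖ + ‖b‖)) (sq_nonneg u)
  have h6 := mul_le_mul_of_nonneg_right (le_max_right (c + ‖b‖) (‖A‖ + ‖b‖)) (sq_nonneg ‖v‖)
  generalize max (c + ‖b‖) (‖A‖ + ‖b‖) = M at *
  have h7 : M * ‖v‖ ^ 2 + M * u ^ 2 = M := by rw [← mul_add, h, mul_one]
  have h8 : ‖b‖ * ‖v‖ ^ 2 + ‖b‖ * u ^ 2 = ‖b‖ := by rw [← mul_add, h, mul_one]
  linarith
end

section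
/- Let 𝒳 ⊆ ℝ^d be a nonempty compact convex set, let each ℓ_i : 𝒳 → [0, B_ℓ] be continuous and convex, and let f : [0,∞) → [0, B_f] be convex with f(1) = 0 and B_f ≥ 1. Define h(ν) = ν + inf_{x∈𝒳} sup_{q∈Δ^N} Σ_{i∈[N]} ( q_i ℓ_i(x) − (ν/N) f(N q_i) ) for ν ≥ 0. Then: (i) h is B_f-Lipschitz on [0,∞); (ii) h is nondecreasing on [B_ℓ, ∞); and consequently (iii) inf_{ν ≥ 0} h(ν) = inf_{ν ∈ [0, B_ℓ]} h(ν). -/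
/-- For nonempty compact convex `𝒳`, continuous convex losses with values
in `[0, B_ℓ]`, and convex `f : [0,∞) → [0, B_f]` with `f(1) = 0`, `B_f ≥ 1`, the function
`h(ν) = ν + inf_{x∈𝒳} sup_{q∈Δ^N} Σ (q_i ℓ_i(x) − (ν/N) f(N q_i))` is `B_f`-Lipschitz on
`[0,∞)`, nondecreasing on `[B_ℓ, ∞)`, and consequently
`inf_{ν ≥ 0} h(ν) = inf_{ν ∈ [0, B_ℓ]} h(ν)`. -/
theorem stmt18 {d N : ℕ} (hN : 1 ≤ N)
    (𝒳 : Set (EuclideanSpace ℝ (Fin d)))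
    (hne : 𝒳.Nonempty) (hcomp : IsCompact 𝒳) (hconv : Convex ℝ 𝒳)
    (Bℓ Bf : ℝ) (hBf : 1 ≤ Bf)
    (ℓ : Fin N → EuclideanSpace ℝ (Fin d) → ℝ)
    (hcont : ∀ i, ContinuousOn (ℓ i) 𝒳) (hℓconv : ∀ i, ConvexOn ℝ 𝒳 (ℓ i))
    (hbound : ∀ i, ∀ x ∈ 𝒳, ℓ i x ∈ Set.Icc 0 Bℓ)
    (f : ℝ → ℝ) (hf : ConvexOn ℝ (Set.Ici 0) f) (hf1 : f 1 = 0)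
    (hfb : ∀ t, 0 ≤ t → f t ∈ Set.Icc 0 Bf)
    (h : ℝ → ℝ)
    (hh : ∀ ν, h ν = ν + sInf {v : ℝ | ∃ x ∈ 𝒳,
        v = sSup {u : ℝ | ∃ q ∈ stdSimplex ℝ (Fin N),
          u = ∑ i, (q i * ℓ i x - (ν / (N : ℝ)) * f ((N : ℝ) * q i))}}) :
    (∀ ν₁ ν₂ : ℝ, 0 ≤ ν₁ → 0 ≤ ν₂ → |h ν₁ - h ν₂| ≤ Bf * |ν₁ - ν₂|) ∧
    (∀ ν₁ ν₂ : ℝ, Bℓ ≤ ν₁ → ν₁ ≤ ν₂ → h ν₁ ≤ h ν₂) ∧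
    sInf {v : ℝ | ∃ ν : ℝ, 0 ≤ ν ∧ v = h ν} =
      sInf {v : ℝ | ∃ ν ∈ Set.Icc (0 : ℝ) Bℓ, v = h ν} := by
  classical
  have hNpos : (0 : ℝ) < N := by exact_mod_cast hN
  obtain ⟨x₀, hx₀⟩ := hne
  have hB0 : 0 ≤ Bℓ := by
    have := hbound ⟨0, hN⟩ x₀ hx₀
    exact this.1.trans this.2
  set V : ℝ → EuclideanSpace ℝ (Fin d) → (Fin N → ℝ) → ℝ := fun ν x q =>
    ∑ i, (q i * ℓ i x - (ν / (N : ℝ)) * f ((N : ℝ) * q i)) with hV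
  set D : (Fin N → ℝ) → ℝ := fun q => (∑ i, f ((N : ℝ) * q i)) / N with hD
  set L : EuclideanSpace ℝ (Fin d) → (Fin N → ℝ) → ℝ := fun x q => ∑ i, q i * ℓ i x with hL
  have hVe : ∀ ν x q, V ν x q = L x q - ν * D q := by
    intro ν x q
    simp only [hV, hD, hL, Finset.sum_sub_distrib, ← Finset.mul_sum]
    ring
  have hD0 : ∀ q ∈ stdSimplex ℝ (Fin N), 0 ≤ D q := by
    intro q hq
    exact div_nonneg (Finset.sum_nonneg fun i _ =>
      (hfb _ (mul_nonneg hNpos.le (hq.1 i))).1) hNpos.le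
  have hD1 : ∀ q ∈ stdSimplex ℝ (Fin N), D q ≤ Bf := by
    intro q hq
    rw [hD]
    simp only
    rw [div_le_iff₀ hNpos]
    calc ∑ i, f ((N : ℝ) * q i) ≤ ∑ _i : Fin N, Bf := Finset.sum_le_sum fun i _ =>
          (hfb _ (mul_nonneg hNpos.le (hq.1 i))).2
      _ = Bf * N := by simp [mul_comm]
  have hL0 : ∀ x ∈ 𝒳, ∀ q ∈ stdSimplex ℝ (Fin N), 0 ≤ L x q := by
    intro x hx q hq
    exact Finset.sum_nonneg fun i _ => mul_nonneg (hq.1 i) (hbound i x hx).1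
  have hL1 : ∀ x ∈ 𝒳, ∀ q ∈ stdSimplex ℝ (Fin N), L x q ≤ Bℓ := by
    intro x hx q hq
    calc L x q ≤ ∑ i, q i * Bℓ := Finset.sum_le_sum fun i _ =>
          mul_le_mul_of_nonneg_left (hbound i x hx).2 (hq.1 i)
      _ = Bℓ := by rw [← Finset.sum_mul, hq.2, one_mul]
  have hu : ∃ u ∈ stdSimplex ℝ (Fin N), D u = 0 := by
    refine ⟨fun _ => (N : ℝ)⁻¹, ⟨fun _ => by positivity, ?_⟩, ?_⟩
    · simp [hNpos.ne']
    · simp [hD, hNpos.ne', hf1]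
  obtain ⟨u, hu, hDu⟩ := hu
  set G : ℝ → EuclideanSpace ℝ (Fin d) → ℝ := fun ν x =>
    sSup {w : ℝ | ∃ q ∈ stdSimplex ℝ (Fin N), w = V ν x q} with hG
  have hle : ∀ ν, 0 ≤ ν → ∀ x ∈ 𝒳, ∀ q ∈ stdSimplex ℝ (Fin N), V ν x q ≤ G ν x := by
    intro ν hν x hx q hq
    refine le_csSup ⟨Bℓ, ?_⟩ ⟨q, hq, rfl⟩
    rintro _ ⟨p, hp, rfl⟩
    rw [hVe]
    nlinarith [hL1 x hx p hp, mul_nonneg hν (hD0 p hp)]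
  have hGle : ∀ ν x c, (∀ q ∈ stdSimplex ℝ (Fin N), V ν x q ≤ c) → G ν x ≤ c := by
    intro ν x c hc
    refine csSup_le ⟨_, u, hu, rfl⟩ ?_
    rintro _ ⟨p, hp, rfl⟩
    exact hc p hp
  have hG0 : ∀ ν, 0 ≤ ν → ∀ x ∈ 𝒳, 0 ≤ G ν x := by
    intro ν hν x hx
    refine le_trans ?_ (hle ν hν x hx u hu)
    rw [hVe, hDu]
    linarith [hL0 x hx u hu]
  set I : ℝ → ℝ := fun ν => sInf {v : ℝ | ∃ x ∈ 𝒳, v = G ν x} with hI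
  have hh' : ∀ ν, h ν = ν + I ν := hh
  have hI0 : ∀ ν, 0 ≤ ν → 0 ≤ I ν := by
    intro ν hν
    refine le_csInf ⟨_, x₀, hx₀, rfl⟩ ?_
    rintro _ ⟨x, hx, rfl⟩
    exact hG0 ν hν x hx
  have hcmp : ∀ a b c, 0 ≤ a → (∀ x ∈ 𝒳, G a x ≤ G b x + c) → I a ≤ I b + c := by
    intro a b c ha hc
    rw [← sub_le_iff_le_add]
    refine le_csInf ⟨_, x₀, hx₀, rfl⟩ ?_
    rintro _ ⟨x, hx, rfl⟩
    rw [sub_le_iff_le_add]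
    refine le_trans (csInf_le ⟨0, ?_⟩ ⟨x, hx, rfl⟩) (hc x hx)
    rintro _ ⟨y, hy, rfl⟩
    exact hG0 a ha y hy
  have hA : ∀ a b, 0 ≤ a → a ≤ b → I b ≤ I a := by
    intro a b ha hab
    have := hcmp b a 0 (ha.trans hab) (fun x hx => hGle _ _ _ fun q hq => by
      have h1 := hle a ha x hx q hq
      rw [hVe] at h1 ⊢
      nlinarith [hD0 q hq])
    linarith
  have hC : ∀ a b, 0 ≤ a → a ≤ b → I a ≤ I b + Bf * (b - a) := by
    intro a b ha hab
    exact hcmp a b _ ha (fun x hx => hGle _ _ _ fun q hq => by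
      have h1 := hle b (ha.trans hab) x hx q hq
      rw [hVe] at h1 ⊢
      nlinarith [hD1 q hq])
  have hM : ∀ a b, Bℓ ≤ a → a ≤ b → h a ≤ h b := by
    intro a b ha hab
    have ha0 := hB0.trans ha
    have := hcmp a b (b - a) ha0 (fun x hx => hGle _ _ _ fun q hq => by
      rw [hVe]
      by_cases hq1 : D q ≤ 1
      · have h1 := hle b (ha0.trans hab) x hx q hq
        rw [hVe] at h1
        nlinarith
      · have h1 := hG0 b (ha0.trans hab) x hx
        nlinarith [hL1 x hx q hq])
    rw [hh', hh']
    linarith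
  have hLip : ∀ a b, 0 ≤ a → a ≤ b → |h a - h b| ≤ Bf * |a - b| := by
    intro a b ha hab
    have h1 := hA a b ha hab
    have h2 := hC a b ha hab
    rw [hh', hh', abs_sub_comm a b, abs_of_nonneg (sub_nonneg.2 hab), abs_le]
    constructor <;> nlinarith
  refine ⟨?_, hM, ?_⟩
  · intro a b ha hb
    rcases le_total a b with hab | hab
    · exact hLip a b ha hab
    · rw [abs_sub_comm, abs_sub_comm a b]
      exact hLip b a hb hab
  · have hpos : ∀ ν, 0 ≤ ν → 0 ≤ h ν := by
      intro ν hν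
      rw [hh']
      linarith [hI0 ν hν]
    apply le_antisymm
    · refine csInf_le_csInf ⟨0, ?_⟩ ⟨_, 0, ⟨le_rfl, hB0⟩, rfl⟩ ?_
      · rintro _ ⟨ν, hν, rfl⟩
        exact hpos ν hν
      · rintro _ ⟨ν, hν, rfl⟩
        exact ⟨ν, hν.1, rfl⟩
    · refine le_csInf ⟨_, 0, le_rfl, rfl⟩ ?_
      have hbd : BddBelow {v : ℝ | ∃ ν ∈ Set.Icc (0 : ℝ) Bℓ, v = h ν} := by
        refine ⟨0, ?_⟩
        rintro _ ⟨ν, hν, rfl⟩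
        exact hpos ν hν.1
      rintro _ ⟨ν, hν, rfl⟩
      rcases le_total ν Bℓ with hc | hc
      · exact csInf_le hbd ⟨ν, ⟨hν, hc⟩, rfl⟩
      · exact (csInf_le hbd ⟨Bℓ, ⟨hB0, le_rfl⟩, rfl⟩).trans (hM _ _ le_rfl hc)
end
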